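/- arXiv:2204.06953 — 13 statements merged into one kernel-verified Lean document; each statement's English description precedes it below -/
import Mathlib

section
/- Let x, y ∈ ℝ^n. Then x is majorized by y if and only if x can be written as a convex combination of at most n permutations of y, i.e., there exist m ≤ n permutations σ_1, …, σ_m of the coordinates and nonnegative coefficients c_1, …, c_m summing to 1 such that x = Σ_{j=1}^m c_j (y ∘ σ_j). -/
/-- The vector `x` rearranged so that its components are in decreasing order:
`Tuple.sort (-x)` is a permutation making `-x` monotone, i.e. `x` antitone. -/
noncomputable def sortedDesc {n : ℕ} (x : Fin n → ℝ) : Fin n → ℝ :=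
  fun i => x (Tuple.sort (fun j => -x j) i)

/-- `x` is majorized by `y`: the partial sums of the decreasingly ordered components
satisfy `∑_{i=1}^k x_[i] ≤ ∑_{i=1}^k y_[i]` for `1 ≤ k ≤ n-1`, and the total sums agree. -/
def IsMajorizedBy {n : ℕ} (x y : Fin n → ℝ) : Prop :=
  (∀ k : ℕ, 1 ≤ k → k ≤ n - 1 →
      ∑ i ∈ Finset.univ.filter (fun i : Fin n => (i : ℕ) < k), sortedDesc x i ≤
        ∑ i ∈ Finset.univ.filter (fun i : Fin n => (i : ℕ) < k), sortedDesc y i) ∧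
    ∑ i, x i = ∑ i, y i

theorem sortedDesc_antitone {n : ℕ} (x : Fin n → ℝ) : Antitone (sortedDesc x) := by
  intro i j hij
  have h := Tuple.monotone_sort (fun j => -x j) hij
  simp only [Function.comp_apply, neg_le_neg_iff] at h
  exact h

/-- Every rearrangement of a vector is a rearrangement of its decreasing rearrangement. -/
theorem apply_eq_sortedDesc_symm {n : ℕ} (x : Fin n → ℝ) (i : Fin n) :
    x i = sortedDesc x ((Tuple.sort (fun j => -x j)).symm i) := by
  simp [sortedDesc]

theorem sum_sortedDesc {n : ℕ} (x : Fin n → ℝ) : ∑ i, sortedDesc x i = ∑ i, x i :=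
  Equiv.sum_comp (Tuple.sort (fun j => -x j)) x

/-- Rearrangement inequality for two decreasing vectors. -/
theorem sum_mul_comp_perm_le_of_antitone {n : ℕ} {a b : Fin n → ℝ}
    (ha : Antitone a) (hb : Antitone b) (π : Equiv.Perm (Fin n)) :
    ∑ i, a i * b (π i) ≤ ∑ i, a i * b i :=
  (ha.monovary hb).sum_mul_comp_perm_le_sum_mul

/-- Abel summation: pairing a decreasing vector with one having nonnegative partial sums. -/
theorem last_mul_sum_le_sum_mul_of_antitone (n : ℕ) (a d : Fin (n + 1) → ℝ) (ha : Antitone a)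
    (hd : ∀ k ≤ n, 0 ≤ ∑ i : Fin (n + 1), if (i : ℕ) < k then d i else 0) :
    a (Fin.last n) * ∑ i, d i ≤ ∑ i, a i * d i := by
  induction n with
  | zero => simp
  | succ n ih =>
    have key := ih (fun i => a i.castSucc) (fun i => d i.castSucc)
      (fun i j h => ha (Fin.castSucc_le_castSucc_iff.2 h)) (fun k hk => by
        have h := hd k (by omega)
        rw [Fin.sum_univ_castSucc] at h
        simpa [show ¬ n + 1 < k by omega] using h)
    have hS : 0 ≤ ∑ i : Fin (n + 1), d i.castSucc := by
      have h := hd (n + 1) le_rfl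
      rw [Fin.sum_univ_castSucc] at h
      simpa [Nat.lt_succ_iff, fun i : Fin (n + 1) => Nat.le_of_lt_succ i.isLt] using h
    have hle : a (Fin.last (n + 1)) ≤ a (Fin.last n).castSucc := ha (Fin.le_last _)
    rw [Fin.sum_univ_castSucc, Fin.sum_univ_castSucc (fun i => a i * d i), mul_add]
    have := mul_le_mul_of_nonneg_right hle hS
    linarith

/-- A decreasing weight pairs at least as much with the majorizing vector. -/
theorem IsMajorizedBy.sum_mul_sortedDesc_le {n : ℕ} {x y : Fin n → ℝ} (h : IsMajorizedBy x y)
    {a : Fin n → ℝ} (ha : Antitone a) :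
    ∑ i, a i * sortedDesc x i ≤ ∑ i, a i * sortedDesc y i := by
  cases n with
  | zero => simp
  | succ n =>
    have key := last_mul_sum_le_sum_mul_of_antitone n a (fun i => sortedDesc y i - sortedDesc x i)
      ha (fun k hk => by
        rw [← Finset.sum_filter, Finset.sum_sub_distrib, sub_nonneg]
        rcases Nat.eq_zero_or_pos k with rfl | hk0
        · simp
        · exact h.1 k hk0 (by omega))
    have h0 : ∑ i, (sortedDesc y i - sortedDesc x i) = 0 := by
      rw [Finset.sum_sub_distrib, sum_sortedDesc, sum_sortedDesc, h.2, sub_self]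
    rw [h0, mul_zero] at key
    simp only [mul_sub, Finset.sum_sub_distrib] at key
    linarith

/-- Any linear functional at a majorized vector is dominated by its value at some permutation of
the majorizing vector. -/
theorem IsMajorizedBy.exists_perm_sum_mul_le {n : ℕ} {x y : Fin n → ℝ} (h : IsMajorizedBy x y)
    (a : Fin n → ℝ) :
    ∃ σ : Equiv.Perm (Fin n), ∑ i, a i * x i ≤ ∑ i, a i * y (σ i) := by
  set r := Tuple.sort (fun j => -a j) with hr
  set p := Tuple.sort (fun j => -x j) with hp
  set q := Tuple.sort (fun j => -y j) with hq
  refine ⟨r.symm.trans q, ?_⟩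
  calc ∑ i, a i * x i = ∑ i, sortedDesc a i * sortedDesc x ((r.trans p.symm) i) := by
        rw [← Equiv.sum_comp r]
        simp [sortedDesc, ← hr, ← hp]
    _ ≤ ∑ i, sortedDesc a i * sortedDesc x i :=
        sum_mul_comp_perm_le_of_antitone (sortedDesc_antitone a) (sortedDesc_antitone x) _
    _ ≤ ∑ i, sortedDesc a i * sortedDesc y i := h.sum_mul_sortedDesc_le (sortedDesc_antitone a)
    _ = ∑ i, a i * y ((r.symm.trans q) i) := by
        rw [← Equiv.sum_comp r (fun i => a i * y ((r.symm.trans q) i))]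
        simp [sortedDesc, ← hr, ← hq]

theorem IsMajorizedBy.mem_convexHull {n : ℕ} {x y : Fin n → ℝ} (h : IsMajorizedBy x y) :
    x ∈ convexHull ℝ (Set.range fun σ : Equiv.Perm (Fin n) => fun i => y (σ i)) := by
  by_contra hx
  obtain ⟨f, u, hfu, hux⟩ := geometric_hahn_banach_closed_point (convex_convexHull ℝ _)
    ((Set.finite_range fun σ : Equiv.Perm (Fin n) => fun i => y (σ i)).isClosed_convexHull ℝ) hx
  have hf : ∀ v : Fin n → ℝ, f v = ∑ i, f (Pi.single i 1) * v i := fun v => by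
    have := LinearMap.pi_apply_eq_sum_univ f.toLinearMap v
    simp only [ContinuousLinearMap.coe_coe, smul_eq_mul] at this
    rw [this]
    refine Finset.sum_congr rfl fun i _ => ?_
    rw [mul_comm]
    congr 2
    ext j
    simp [Pi.single_apply, eq_comm]
  obtain ⟨σ, hσ⟩ := h.exists_perm_sum_mul_le fun i => f (Pi.single i 1)
  rw [← hf, ← hf fun i => y (σ i)] at hσ
  have := hfu _ (subset_convexHull ℝ _ ⟨σ, rfl⟩)
  linarith

/-- An affinely independent family of vectors in `ℝⁿ` with a common coordinate sum has at most
`n` members. -/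
theorem AffineIndependent.card_le_of_sum_eq {n : ℕ} (hn : 0 < n) {ι : Type*} [Fintype ι]
    {z : ι → Fin n → ℝ} (hz : AffineIndependent ℝ z) {s : ℝ} (hs : ∀ j, ∑ i, z j i = s) :
    Fintype.card ι ≤ n := by
  set S : (Fin n → ℝ) →ₗ[ℝ] ℝ := ∑ i, LinearMap.proj i with hS
  have hSa : ∀ v, S v = ∑ i, v i := fun v => by simp [hS]
  have hle : vectorSpan ℝ (Set.range z) ≤ LinearMap.ker S := by
    refine Submodule.span_le.2 ?_
    rintro _ ⟨_, ⟨j, rfl⟩, _, ⟨k, rfl⟩, rfl⟩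
    change S (z j - z k) = 0
    rw [map_sub, hSa, hSa, hs, hs, sub_self]
  have hlt : Module.finrank ℝ (LinearMap.ker S) < Module.finrank ℝ (Fin n → ℝ) := by
    refine Submodule.finrank_lt fun htop => ?_
    have h1 : S (Pi.single ⟨0, hn⟩ 1) = 0 := by
      rw [← LinearMap.mem_ker, htop]
      trivial
    rw [hSa, Finset.sum_pi_single'] at h1
    simp at h1
  have h1 := hz.card_le_finrank_succ
  have h2 := Submodule.finrank_mono hle
  rw [Module.finrank_fin_fun] at hlt
  omega

theorem isMajorizedBy_of_eq_convex_combination {n m : ℕ} {x y : Fin n → ℝ} {c : Fin m → ℝ}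
    {σ : Fin m → Equiv.Perm (Fin n)} (hc : ∀ j, 0 ≤ c j) (hc1 : ∑ j, c j = 1)
    (hx : ∀ i, x i = ∑ j, c j * y (σ j i)) : IsMajorizedBy x y := by
  refine ⟨fun k _ _ => ?_, ?_⟩
  · set w : Fin n → ℝ := fun i => if (i : ℕ) < k then 1 else 0 with hw
    have hwa : Antitone w := fun i j hij => by
      have hij' : (i : ℕ) ≤ j := hij
      simp only [hw]
      split_ifs <;> first | omega | norm_num
    have hsum : ∀ v : Fin n → ℝ,
        ∑ i ∈ Finset.univ.filter (fun i : Fin n => (i : ℕ) < k), v i = ∑ i, w i * v i := fun v => by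
      simp [hw, Finset.sum_filter]
    rw [hsum, hsum]
    set p := Tuple.sort (fun j => -x j) with hp
    set q := Tuple.sort (fun j => -y j) with hq
    calc ∑ i, w i * sortedDesc x i
        = ∑ i, ∑ j, c j * (w i * sortedDesc y (((p.trans (σ j)).trans q.symm) i)) := by
          refine Finset.sum_congr rfl fun i _ => ?_
          rw [sortedDesc, hx, Finset.mul_sum]
          refine Finset.sum_congr rfl fun j _ => ?_
          rw [apply_eq_sortedDesc_symm y]
          simp only [Equiv.trans_apply, ← hp, ← hq]
          ring
      _ = ∑ j, c j * ∑ i, w i * sortedDesc y (((p.trans (σ j)).trans q.symm) i) := by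
          rw [Finset.sum_comm]
          simp only [Finset.mul_sum]
      _ ≤ ∑ j, c j * ∑ i, w i * sortedDesc y i :=
          Finset.sum_le_sum fun j _ => mul_le_mul_of_nonneg_left
            (sum_mul_comp_perm_le_of_antitone hwa (sortedDesc_antitone y) _) (hc j)
      _ = ∑ i, w i * sortedDesc y i := by rw [← Finset.sum_mul, hc1, one_mul]
  · simp only [hx]
    rw [Finset.sum_comm]
    simp only [← Finset.mul_sum, Equiv.sum_comp, ← Finset.sum_mul, hc1, one_mul]

/-- Rado's theorem (with Carathéodory bound, after Zhan): `x` is majorized by `y`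
iff `x` is a convex combination of at most `n` permutations of `y`. -/
theorem majorized_iff_convex_combination_of_permutations
    (n : ℕ) (hn : 0 < n) (x y : Fin n → ℝ) :
    IsMajorizedBy x y ↔
      ∃ m : ℕ, m ≤ n ∧
        ∃ (c : Fin m → ℝ) (σ : Fin m → Equiv.Perm (Fin n)),
          (∀ j, 0 ≤ c j) ∧ (∑ j, c j = 1) ∧
            x = fun i => ∑ j, c j * y (σ j i) := by
  constructor
  · intro h
    obtain ⟨ι, _, z, w, hzs, hz, hw, hw1, hwz⟩ :=
      eq_pos_convex_span_of_mem_convexHull h.mem_convexHull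
    choose τ hτ using fun j => hzs (Set.mem_range_self j)
    have hcard : Fintype.card ι ≤ n := hz.card_le_of_sum_eq hn (s := ∑ i, y i) fun j => by
      rw [← hτ j]
      exact Equiv.sum_comp (τ j) y
    let e := (Fintype.equivFin ι).symm
    refine ⟨Fintype.card ι, hcard, fun j => w (e j), fun j => τ (e j), fun j => (hw _).le, ?_, ?_⟩
    · rw [Equiv.sum_comp e w, hw1]
    · funext i
      rw [Equiv.sum_comp e fun j => w j * y (τ j i), ← hwz, Finset.sum_apply]
      refine Finset.sum_congr rfl fun j _ => ?_
      rw [← hτ j]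
      rfl
  · rintro ⟨m, -, c, σ, hc, hc1, hx⟩
    exact isMajorizedBy_of_eq_convex_combination hc hc1 (congrFun hx)
end

section
/- For integers 0 ≤ k ≤ n, the convex hull in the real vector space of n×n complex Hermitian matrices of the set G_k(ℂ^n) = {A Hermitian : A² = A, tr A = k} equals H_k(ℂ^n) = {A Hermitian : A is positive semidefinite, I_n − A is positive semidefinite, tr A = k}. -/
open ComplexOrder

/-- The points of the hypersimplex are convex combinations of its `0/1` points. -/
theorem mem_convexHull_zero_one_of_sum_eq {ι : Type*} [Fintype ι] (k : ℕ) (v : ι → ℝ)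
    (h0 : ∀ i, 0 ≤ v i) (h1 : ∀ i, v i ≤ 1) (hs : ∑ i, v i = k) :
    v ∈ convexHull ℝ {w : ι → ℝ | (∀ i, w i = 0 ∨ w i = 1) ∧ ∑ i, w i = k} := by
  classical
  induction hm : (Finset.univ.filter fun i => v i ≠ 0 ∧ v i ≠ 1).card using Nat.strong_induction_on
    generalizing v with
  | _ m ih =>
  subst hm
  by_cases hv : ∀ i, v i = 0 ∨ v i = 1
  · exact subset_convexHull ℝ _ ⟨hv, hs⟩
  push Not at hv
  obtain ⟨i, hi0, hi1⟩ := hv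
  have hi0' : 0 < v i := lt_of_le_of_ne (h0 i) hi0.symm
  have hi1' : v i < 1 := lt_of_le_of_ne (h1 i) hi1
  obtain ⟨j, hji, hj0, hj1⟩ : ∃ j, j ≠ i ∧ v j ≠ 0 ∧ v j ≠ 1 := by
    by_contra! hne
    have hrest : ∑ j ∈ Finset.univ.erase i, v j =
        (((Finset.univ.erase i).filter fun j => v j ≠ 0).card : ℕ) := by
      rw [Finset.card_filter, Nat.cast_sum]
      refine Finset.sum_congr rfl fun j hj => ?_
      by_cases hj0 : v j = 0
      · simp [hj0]
      · simp [hne j (Finset.ne_of_mem_erase hj) hj0]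
    rw [← Finset.add_sum_erase _ _ (Finset.mem_univ i), hrest] at hs
    generalize ((Finset.univ.erase i).filter fun j => v j ≠ 0).card = c at hs
    have hlt : c < k := by exact_mod_cast (by linarith : (c : ℝ) < k)
    have hlt' : k < c + 1 := by exact_mod_cast (by linarith : (k : ℝ) < c + 1)
    omega
  have hj0' : 0 < v j := lt_of_le_of_ne (h0 j) hj0.symm
  have hj1' : v j < 1 := lt_of_le_of_ne (h1 j) hj1
  let d : ι → ℝ := Pi.single i 1 - Pi.single j 1
  have hdi : d i = 1 := by simp [d, hji]
  have hdj : d j = -1 := by simp [d, hji]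
  have hd : ∀ l, l ≠ i → l ≠ j → d l = 0 := fun l hli hlj => by simp [d, hli, hlj]
  have hdsum : ∑ l, d l = 0 := by simp [d]
  have key : ∀ t : ℝ, 0 ≤ v i + t → v i + t ≤ 1 → 0 ≤ v j - t → v j - t ≤ 1 →
      (v i + t = 0 ∨ v i + t = 1 ∨ v j - t = 0 ∨ v j - t = 1) →
      v + t • d ∈ convexHull ℝ {w : ι → ℝ | (∀ i, w i = 0 ∨ w i = 1) ∧ ∑ i, w i = k} := by
    intro t hti hti' htj htj' hend
    have ei : (v + t • d) i = v i + t := by simp [hdi]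
    have ej : (v + t • d) j = v j - t := by simp [hdj, sub_eq_add_neg]
    have el : ∀ l, l ≠ i → l ≠ j → (v + t • d) l = v l := fun l hli hlj => by
      simp [hd l hli hlj]
    have hall : ∀ l, 0 ≤ (v + t • d) l ∧ (v + t • d) l ≤ 1 := by
      intro l
      by_cases hli : l = i
      · subst hli; rw [ei]; exact ⟨hti, hti'⟩
      by_cases hlj : l = j
      · subst hlj; rw [ej]; exact ⟨htj, htj'⟩
      · rw [el l hli hlj]; exact ⟨h0 l, h1 l⟩
    refine ih _ ?_ _ (fun l => (hall l).1) (fun l => (hall l).2) ?_ rfl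
    · apply Finset.card_lt_card
      rw [Finset.ssubset_iff_of_subset]
      · rcases hend with h | h | h | h
        · exact ⟨i, by simp [hi0, hi1], by simp only [Finset.mem_filter, ei]; tauto⟩
        · exact ⟨i, by simp [hi0, hi1], by simp only [Finset.mem_filter, ei]; tauto⟩
        · exact ⟨j, by simp [hj0, hj1], by simp only [Finset.mem_filter, ej]; tauto⟩
        · exact ⟨j, by simp [hj0, hj1], by simp only [Finset.mem_filter, ej]; tauto⟩
      · intro l hl
        by_cases hli : l = i
        · subst hli; simp [hi0, hi1]
        by_cases hlj : l = j
        · subst hlj; simp [hj0, hj1]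
        · simpa only [Finset.mem_filter, el l hli hlj] using hl
    · simp [Finset.sum_add_distrib, ← Finset.mul_sum, hdsum, hs]
  obtain ⟨a, ha, hamem⟩ : ∃ a : ℝ, 0 < a ∧ v + (-a) • d ∈
      convexHull ℝ {w : ι → ℝ | (∀ i, w i = 0 ∨ w i = 1) ∧ ∑ i, w i = k} := by
    rcases le_total (v i) (1 - v j) with h | h
    · exact ⟨v i, hi0', key _ (by linarith) (by linarith) (by linarith) (by linarith)
        (Or.inl (by ring))⟩
    · exact ⟨1 - v j, by linarith, key _ (by linarith) (by linarith) (by linarith) (by linarith)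
        (Or.inr (Or.inr (Or.inr (by ring))))⟩
  obtain ⟨b, hb, hbmem⟩ : ∃ b : ℝ, 0 < b ∧ v + b • d ∈
      convexHull ℝ {w : ι → ℝ | (∀ i, w i = 0 ∨ w i = 1) ∧ ∑ i, w i = k} := by
    rcases le_total (1 - v i) (v j) with h | h
    · exact ⟨1 - v i, by linarith, key _ (by linarith) (by linarith) (by linarith) (by linarith)
        (Or.inr (Or.inl (by ring)))⟩
    · exact ⟨v j, hj0', key _ (by linarith) (by linarith) (by linarith) (by linarith)
        (Or.inr (Or.inr (Or.inl (by ring))))⟩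
  have hab : a + b ≠ 0 := by positivity
  have hcomb := convex_convexHull ℝ _ hamem hbmem (a := b / (a + b)) (b := a / (a + b))
    (by positivity) (by positivity) (by field_simp; ring)
  convert hcomb using 1
  ext l
  simp only [Pi.add_apply, Pi.smul_apply, smul_eq_mul]
  field_simp
  ring

/-- A Hermitian idempotent matrix is positive semidefinite. -/
theorem Matrix.IsHermitian.posSemidef_of_mul_self {n : Type*} [Fintype n] {A : Matrix n n ℂ}
    (hA : A.IsHermitian) (hAA : A * A = A) : A.PosSemidef := by
  have h := Matrix.posSemidef_conjTranspose_mul_self A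
  rwa [hA.eq, hAA] at h

/-- Conjugation of a real diagonal matrix, as a real-linear map in the diagonal. -/
noncomputable def conjDiagonal {n : Type*} [Fintype n] [DecidableEq n] (U : Matrix n n ℂ) :
    (n → ℝ) →ₗ[ℝ] Matrix n n ℂ where
  toFun v := U * Matrix.diagonal (fun i => (v i : ℂ)) * star U
  map_add' v w := by
    simp only [Pi.add_apply, Complex.ofReal_add, ← Matrix.diagonal_add, mul_add, add_mul]
  map_smul' c v := by
    have h : Matrix.diagonal (fun i => (((c • v) i : ℝ) : ℂ)) =
        c • Matrix.diagonal (fun i => (v i : ℂ)) := by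
      rw [← Matrix.diagonal_smul]
      congr 1
      ext i
      simp
    rw [h, Matrix.mul_smul, Matrix.smul_mul, RingHom.id_apply]

/-- Fillmore–Williams: the convex hull (over ℝ) of the complex Grassmannian
`G_k(ℂ^n)`, realized as the set of Hermitian projections of trace `k`, is the set
of Hermitian matrices `A` with `A ⪰ 0`, `I - A ⪰ 0` and `tr A = k`. -/
theorem convexHull_grassmannian_complex (n k : ℕ) (hk : k ≤ n) :
    convexHull ℝ
        {A : Matrix (Fin n) (Fin n) ℂ | A.IsHermitian ∧ A * A = A ∧ A.trace = (k : ℂ)} =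
      {A : Matrix (Fin n) (Fin n) ℂ |
        A.IsHermitian ∧ A.PosSemidef ∧ (1 - A).PosSemidef ∧ A.trace = (k : ℂ)} := by
  apply Set.Subset.antisymm
  · apply convexHull_min
    · rintro A ⟨hA, hAA, ht⟩
      refine ⟨hA, hA.posSemidef_of_mul_self hAA, ?_, ht⟩
      exact (Matrix.isHermitian_one.sub hA).posSemidef_of_mul_self
        (by simp [mul_sub, sub_mul, hAA])
    · rintro A ⟨-, hA, hA', hAt⟩ B ⟨-, hB, hB', hBt⟩ a b ha hb hab
      have hP : (a • A + b • B).PosSemidef := (hA.smul ha).add (hB.smul hb)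
      refine ⟨hP.isHermitian, hP, ?_, ?_⟩
      · have h : 1 - (a • A + b • B) = a • (1 - A) + b • (1 - B) := by
          have h1 : (1 : Matrix (Fin n) (Fin n) ℂ) = a • 1 + b • 1 := by
            rw [← add_smul, hab, one_smul]
          rw [smul_sub, smul_sub]
          nth_rewrite 1 [h1]
          abel
        rw [h]
        exact (hA'.smul ha).add (hB'.smul hb)
      · rw [Matrix.trace_add, Matrix.trace_smul, Matrix.trace_smul, hAt, hBt, ← add_smul, hab,
          one_smul]
  · rintro A ⟨hA, hP, hP', ht⟩
    let U : Matrix (Fin n) (Fin n) ℂ := hA.eigenvectorUnitary.1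
    have hUU : star U * U = 1 := Unitary.coe_star_mul_self hA.eigenvectorUnitary
    have hAU : A = conjDiagonal U hA.eigenvalues := by
      have h := hA.spectral_theorem
      rw [Unitary.conjStarAlgAut_apply] at h
      exact h
    have hle : ∀ i, hA.eigenvalues i ≤ 1 := by
      have h := hP'.conjTranspose_mul_mul_same U
      have hD : star U * A * U = Matrix.diagonal (fun i => (hA.eigenvalues i : ℂ)) := by
        nth_rewrite 1 [hAU]
        change star U * (U * _ * star U) * U = _
        rw [mul_assoc, mul_assoc, mul_assoc, hUU, mul_one, ← mul_assoc, hUU, one_mul]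
      rw [← Matrix.star_eq_conjTranspose, mul_sub, sub_mul, mul_one, hUU, hD,
        ← Matrix.diagonal_one, Matrix.diagonal_sub, Matrix.posSemidef_diagonal_iff] at h
      intro i
      have hi := h i
      rw [sub_nonneg] at hi
      exact_mod_cast hi
    have hsum : ∑ i, hA.eigenvalues i = k := by
      have h := hA.trace_eq_sum_eigenvalues
      rw [ht] at h
      apply Complex.ofReal_injective
      rw [Complex.ofReal_sum, Complex.ofReal_natCast]
      exact h.symm
    have hmem := Set.mem_image_of_mem (conjDiagonal U)
      (mem_convexHull_zero_one_of_sum_eq k hA.eigenvalues hP.eigenvalues_nonneg hle hsum)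
    rw [← hAU, LinearMap.image_convexHull] at hmem
    refine convexHull_mono ?_ hmem
    rintro _ ⟨w, ⟨hw, hws⟩, rfl⟩
    change (U * _ * star U).IsHermitian ∧ (U * _ * star U) * (U * _ * star U) = U * _ * star U ∧
      (U * _ * star U).trace = (k : ℂ)
    refine ⟨?_, ?_, ?_⟩
    · refine Matrix.isHermitian_mul_mul_conjTranspose U ?_
      exact Matrix.isHermitian_diagonal_of_self_adjoint _ (by ext i; simp)
    · have hDD : Matrix.diagonal (fun i => (w i : ℂ)) * Matrix.diagonal (fun i => (w i : ℂ)) =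
          Matrix.diagonal (fun i => (w i : ℂ)) := by
        rw [Matrix.diagonal_mul_diagonal]
        congr 1
        ext i
        rcases hw i with h | h <;> simp [h]
      calc _ = U * (Matrix.diagonal (fun i => (w i : ℂ)) * (star U * U) *
            Matrix.diagonal (fun i => (w i : ℂ))) * star U := by simp only [mul_assoc]
        _ = _ := by rw [hUU, mul_one, hDD]
    · rw [Matrix.trace_mul_comm, ← mul_assoc, hUU, one_mul, Matrix.trace_diagonal]
      exact_mod_cast hws
end

section
/- For integers 0 ≤ k ≤ n, the set of extreme points of the convex set H_k(ℂ^n) = {A Hermitian n×n : A ⪰ 0, I_n − A ⪰ 0, tr A = k} is exactly G_k(ℂ^n) = {A Hermitian : A² = A, tr A = k}. -/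
open ComplexOrder

/-- If `Qᴴ (a P + b R) Q = 0` with `P`, `R` positive semidefinite and `a, b > 0`, then `P Q = 0`. -/
lemma Matrix.PosSemidef.mul_eq_zero_of_conjTranspose_mul_add_mul {m : Type*} [Fintype m]
    [DecidableEq m] {P R Q : Matrix m m ℂ} (hP : P.PosSemidef) (hR : R.PosSemidef) {a b : ℝ}
    (ha : 0 < a) (hb : 0 < b) (h : Q.conjTranspose * (a • P + b • R) * Q = 0) : P * Q = 0 := by
  have hP' := hP.conjTranspose_mul_mul_same Q
  have hR' := hR.conjTranspose_mul_mul_same Q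
  have ht := congrArg Matrix.trace h
  simp only [Matrix.mul_add, Matrix.add_mul, Matrix.mul_smul, Matrix.smul_mul, Matrix.trace_add,
    Matrix.trace_smul, Matrix.trace_zero] at ht
  have h1 := hP'.trace_nonneg
  have h2 := hR'.trace_nonneg
  have h3 : (Q.conjTranspose * P * Q).trace = 0 := by
    rw [Complex.nonneg_iff] at h1 h2
    have hre := congrArg Complex.re ht
    simp only [Complex.add_re, Complex.smul_re, smul_eq_mul, Complex.zero_re] at hre
    apply Complex.ext
    · simp only [Complex.zero_re]
      nlinarith [mul_nonneg ha.le h1.1, mul_nonneg hb.le h2.1]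
    · simpa using h1.2.symm
  have h4 := hP'.trace_eq_zero_iff.mp h3
  ext i j
  have h5 : star (Q.col j) ⬝ᵥ P.mulVec (Q.col j) = 0 := by
    have := congrFun (congrFun h4 j) j
    rw [Matrix.mul_assoc] at this
    exact this
  exact congrFun ((hP.dotProduct_mulVec_zero_iff _).mp h5) i

/-- A real vector with entries in `[0, 1]` and integer sum which has an entry in `(0, 1)` has
another such entry. -/
lemma exists_ne_pos_lt_one_of_sum_eq_intCast {ι : Type*} [Fintype ι] [DecidableEq ι] {v : ι → ℝ}
    (h0 : ∀ i, 0 ≤ v i) (h1 : ∀ i, v i ≤ 1) {z : ℤ} (hz : ∑ i, v i = z) {i : ι}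
    (hi0 : 0 < v i) (hi1 : v i < 1) : ∃ j, j ≠ i ∧ 0 < v j ∧ v j < 1 := by
  by_contra! H
  have hint : ∀ j, ∃ m : ℤ, j ≠ i → v j = m := fun j ↦ by
    rcases (h0 j).eq_or_lt with h | h
    · exact ⟨0, fun _ ↦ by simp [← h]⟩
    · exact ⟨1, fun hj ↦ by simpa using le_antisymm (h1 j) (H j hj h)⟩
  choose m hm using hint
  rw [← Finset.add_sum_erase _ _ (Finset.mem_univ i),
    Finset.sum_congr rfl fun j hj ↦ hm j (Finset.ne_of_mem_erase hj)] at hz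
  have hv : v i = ((z - ∑ j ∈ Finset.univ.erase i, m j : ℤ) : ℝ) := by
    push_cast
    linarith
  rw [hv] at hi0 hi1
  norm_cast at hi0 hi1
  omega

/-- The extreme points of the real hypersimplex are `0`-`1` vectors. -/
lemma eq_zero_or_one_of_mem_extremePoints_hypersimplex {ι : Type*} [Fintype ι] [DecidableEq ι]
    {z : ℤ} {v : ι → ℝ}
    (hv : v ∈ Set.extremePoints ℝ
      {w : ι → ℝ | (∀ i, 0 ≤ w i) ∧ (∀ i, w i ≤ 1) ∧ ∑ i, w i = z}) (i : ι) :
    v i = 0 ∨ v i = 1 := by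
  obtain ⟨⟨h0, h1, hz⟩, hext⟩ := hv
  by_contra! H
  have hi0 := (h0 i).lt_of_ne' H.1
  have hi1 := (h1 i).lt_of_ne H.2
  obtain ⟨j, hji, hj0, hj1⟩ := exists_ne_pos_lt_one_of_sum_eq_intCast h0 h1 hz hi0 hi1
  obtain ⟨e, he, hlt⟩ : ∃ e : ℝ, 0 < e ∧ e < min (min (v i) (1 - v i)) (min (v j) (1 - v j)) :=
    exists_between (by simp [*])
  simp only [lt_min_iff] at hlt
  set d : ι → ℝ := Pi.single i e - Pi.single j e with hd
  have hdi : d i = e := by simp [hd, hji.symm]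
  have hdj : d j = -e := by simp [hd, hji]
  have hdl : ∀ l, l ≠ i → l ≠ j → d l = 0 := fun l hi hj ↦ by simp [hd, hi, hj]
  have hds : ∑ l, d l = 0 := by simp [hd]
  have hb : ∀ l, |d l| ≤ v l ∧ |d l| ≤ 1 - v l := fun l ↦ by
    by_cases hli : l = i
    · subst hli
      rw [hdi, abs_of_pos he]
      constructor <;> linarith
    · by_cases hlj : l = j
      · subst hlj
        rw [hdj, abs_neg, abs_of_pos he]
        constructor <;> linarith
      · simpa [hdl l hli hlj] using ⟨h0 l, h1 l⟩
  have hmem : v + d = v := by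
    refine @hext (v + d) ⟨fun l ↦ ?_, fun l ↦ ?_, ?_⟩ (v - d) ⟨fun l ↦ ?_, fun l ↦ ?_, ?_⟩
      ⟨1 / 2, 1 / 2, by norm_num, by norm_num, by norm_num, ?_⟩
    · have := neg_abs_le (d l)
      simp only [Pi.add_apply]
      linarith [hb l]
    · have := le_abs_self (d l)
      simp only [Pi.add_apply]
      linarith [hb l]
    · simp [Finset.sum_add_distrib, hds, hz]
    · have := le_abs_self (d l)
      simp only [Pi.sub_apply]
      linarith [hb l]
    · have := neg_abs_le (d l)
      simp only [Pi.sub_apply]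
      linarith [hb l]
    · simp [Finset.sum_sub_distrib, hds, hz]
    · ext l
      simp only [Pi.add_apply, Pi.sub_apply, Pi.smul_apply, smul_eq_mul]
      ring
  have := congrFun hmem i
  simp only [Pi.add_apply, hdi] at this
  linarith

/-- The set of extreme points of
`H_k(ℂ^n) = {A Hermitian : A ⪰ 0, I - A ⪰ 0, tr A = k}` is exactly the Grassmannian
`G_k(ℂ^n) = {A Hermitian : A² = A, tr A = k}`. -/
theorem extremePoints_grassmannian_complex (n k : ℕ) (hk : k ≤ n) :
    Set.extremePoints ℝ
        {A : Matrix (Fin n) (Fin n) ℂ |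
          A.IsHermitian ∧ A.PosSemidef ∧ (1 - A).PosSemidef ∧ A.trace = (k : ℂ)} =
      {A : Matrix (Fin n) (Fin n) ℂ | A.IsHermitian ∧ A * A = A ∧ A.trace = (k : ℂ)} := by
  ext A
  constructor
  · rintro ⟨⟨hA, hA0, hA1, htr⟩, hext⟩
    refine ⟨hA, ?_, htr⟩
    let U := hA.eigenvectorUnitary
    let F : (Fin n → ℝ) → Matrix (Fin n) (Fin n) ℂ := fun w ↦
      Unitary.conjStarAlgAut ℂ _ U (Matrix.diagonal (Complex.ofReal ∘ w))
    have hFA : A = F hA.eigenvalues := hA.spectral_theorem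
    have hF1 (w : Fin n → ℝ) : 1 - F w = F (1 - w) := by
      simp only [F]
      rw [← map_one (Unitary.conjStarAlgAut ℂ (Matrix (Fin n) (Fin n) ℂ) U), ← map_sub,
        ← Matrix.diagonal_one, Matrix.diagonal_sub]
      congr 2
      ext i
      simp
    have hFpos (w : Fin n → ℝ) : (F w).PosSemidef ↔ ∀ i, 0 ≤ w i := by
      simp only [F, Unitary.conjStarAlgAut_apply]
      rw [Matrix.IsUnit.posSemidef_star_right_conjugate_iff Unitary.isUnit_coe,
        Matrix.posSemidef_diagonal_iff]
      simp
    have hFtr (w : Fin n → ℝ) : (F w).trace = ((∑ i, w i : ℝ) : ℂ) := by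
      simp only [F, Unitary.conjStarAlgAut_apply]
      rw [Matrix.trace_mul_cycle, Unitary.coe_star_mul_self, Matrix.one_mul]
      simp [Matrix.trace_diagonal]
    have hFmem (w : Fin n → ℝ) : ((F w).IsHermitian ∧ (F w).PosSemidef ∧ (1 - F w).PosSemidef ∧
        (F w).trace = (k : ℂ)) ↔ (∀ i, 0 ≤ w i) ∧ (∀ i, w i ≤ 1) ∧ ∑ i, w i = (k : ℤ) := by
      rw [hF1, hFpos, hFpos, hFtr, ← and_assoc,
        and_iff_right_of_imp (fun h ↦ ((hFpos w).mpr h).isHermitian)]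
      simp only [Pi.sub_apply, Pi.one_apply, sub_nonneg, Int.cast_natCast]
      norm_cast
    have hFinj : Function.Injective F := fun w w' h ↦ by
      have := Matrix.diagonal_injective ((Unitary.conjStarAlgAut ℂ _ U).injective h)
      exact funext fun i ↦ Complex.ofReal_injective (congrFun this i)
    have hFlin (a b : ℝ) (w w' : Fin n → ℝ) : a • F w + b • F w' = F (a • w + b • w') := by
      have hdiag : Matrix.diagonal (Complex.ofReal ∘ (a • w + b • w')) =
          a • Matrix.diagonal (Complex.ofReal ∘ w) + b • Matrix.diagonal (Complex.ofReal ∘ w') := by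
        rw [← Matrix.diagonal_smul, ← Matrix.diagonal_smul, Matrix.diagonal_add]
        congr 1
        ext i
        simp
      simp only [F, Unitary.conjStarAlgAut_apply]
      rw [hdiag, Matrix.mul_add, Matrix.add_mul, Matrix.mul_smul, Matrix.smul_mul,
        Matrix.mul_smul, Matrix.smul_mul]
    have h01 := eq_zero_or_one_of_mem_extremePoints_hypersimplex (z := k) (v := hA.eigenvalues)
      ⟨(hFmem _).mp (hFA ▸ ⟨hA, hA0, hA1, htr⟩), fun w hw w' hw' ⟨a, b, ha, hb, hab, h⟩ ↦ hFinj <|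
        (hext ((hFmem w).mpr hw) ((hFmem w').mpr hw')
          ⟨a, b, ha, hb, hab, by rw [hFlin, h, ← hFA]⟩).trans hFA⟩
    rw [hFA]
    simp only [F]
    rw [← map_mul, Matrix.diagonal_mul_diagonal]
    congr 2
    ext i
    rcases h01 i with h | h <;> simp [h]
  · rintro ⟨hA, hAA, htr⟩
    have hA1 : (1 - A).IsHermitian := Matrix.isHermitian_one.sub hA
    have hAA1 : (1 - A) * (1 - A) = 1 - A := by
      rw [mul_sub, mul_one, sub_mul, one_mul, hAA, sub_self, sub_zero]
    have hpos {P : Matrix (Fin n) (Fin n) ℂ} (hP : P.IsHermitian) (h : P * P = P) :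
        P.PosSemidef := by
      have := Matrix.posSemidef_conjTranspose_mul_self P
      rwa [hP.eq, h] at this
    refine ⟨⟨hA, hpos hA hAA, hpos hA1 hAA1, htr⟩, ?_⟩
    rintro B ⟨-, hB0, hB1, -⟩ C ⟨-, hC0, hC1, -⟩ ⟨a, b, ha, hb, hab, h⟩
    have hBA : B * (1 - A) = 0 := by
      refine hB0.mul_eq_zero_of_conjTranspose_mul_add_mul hC0 ha hb ?_
      rw [h, hA1.eq, sub_mul, one_mul, hAA, sub_self, zero_mul]
    have hBA' : (1 - B) * A = 0 := by
      refine hB1.mul_eq_zero_of_conjTranspose_mul_add_mul hC1 ha hb ?_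
      have h' : a • (1 - B) + b • (1 - C) = 1 - A := by
        rw [← h, smul_sub, smul_sub, sub_add_sub_comm, ← add_smul, hab, one_smul]
      rw [h', hA.eq, mul_sub, mul_one, hAA, sub_self, zero_mul]
    rw [mul_sub, mul_one, sub_eq_zero] at hBA
    rw [sub_mul, one_mul, sub_eq_zero] at hBA'
    rw [hBA, ← hBA']
end

section
/- For integers 0 ≤ k ≤ n, the set of extreme points of the convex set H_k(ℝ^n) = {A real symmetric n×n : A ⪰ 0, I_n − A ⪰ 0, tr A = k} is exactly G_k(ℝ^n) = {A real symmetric : A² = A, tr A = k}. -/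
open Matrix Unitary

namespace Matrix

variable {m : Type*} [Fintype m]

theorem IsSymm.posSemidef_of_mul_self {A : Matrix m m ℝ} (hs : A.IsSymm) (h : A * A = A) :
    A.PosSemidef := by
  have := posSemidef_conjTranspose_mul_self A
  rwa [conjTranspose_eq_transpose_of_trivial, hs.eq, h] at this

theorem IsSymm.eq_of_trace_mul_self_nonpos {X Y : Matrix m m ℝ} (hX : X.IsSymm) (hY : Y.IsSymm)
    (h : ((X - Y) * (X - Y)).trace ≤ 0) : X = Y := by
  have hs : (X - Y)ᴴ = X - Y := by
    rw [conjTranspose_eq_transpose_of_trivial, (hX.sub hY).eq]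
  have h0 := (posSemidef_conjTranspose_mul_self (X - Y)).trace_nonneg
  rw [hs] at h0
  exact sub_eq_zero.1 (trace_conjTranspose_mul_self_eq_zero_iff.1
    (by rw [hs]; exact le_antisymm h h0))

variable [DecidableEq m]

/-- The slice of the positive semidefinite matrices between `0` and `1` of a given trace. -/
def boundedSlice (m : Type*) [Fintype m] [DecidableEq m] (c : ℝ) : Set (Matrix m m ℝ) :=
  {A | A.IsSymm ∧ A.PosSemidef ∧ (1 - A).PosSemidef ∧ A.trace = c}

theorem PosSemidef.sub_mul_self {A : Matrix m m ℝ} (h₀ : A.PosSemidef)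
    (h₁ : (1 - A).PosSemidef) : (A - A * A).PosSemidef := by
  have h := (h₁.mul_mul_conjTranspose_same A).add (h₀.mul_mul_conjTranspose_same (1 - A))
  rw [h₀.isHermitian.eq, h₁.isHermitian.eq] at h
  convert h using 1
  noncomm_ring

theorem mem_extremePoints_boundedSlice {A : Matrix m m ℝ} {c : ℝ} (hs : A.IsSymm)
    (hA : A * A = A) (hc : A.trace = c) : A ∈ Set.extremePoints ℝ (boundedSlice m c) := by
  have h₁ : (1 - A).PosSemidef := by
    refine IsSymm.posSemidef_of_mul_self (isSymm_one.sub hs) ?_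
    simp [sub_mul, mul_sub, hA]
  refine mem_extremePoints_iff_left.2 ⟨⟨hs, hs.posSemidef_of_mul_self hA, h₁, hc⟩, ?_⟩
  rintro X ⟨hXs, hX₀, hX₁, hXc⟩ Y ⟨hYs, hY₀, hY₁, hYc⟩ ⟨a, b, ha, hb, hab, rfl⟩
  have hX := (hX₀.sub_mul_self hX₁).trace_nonneg
  have hY := (hY₀.sub_mul_self hY₁).trace_nonneg
  have hsq := congrArg trace hA
  rw [hc] at hsq
  have key : X = Y := by
    refine hXs.eq_of_trace_mul_self_nonpos hYs ?_
    simp only [trace_sub, trace_add, trace_smul, smul_eq_mul, add_mul, mul_add, sub_mul, mul_sub,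
      smul_mul_assoc, mul_smul_comm, hXc, hYc, trace_mul_comm Y X] at hX hY hsq ⊢
    obtain rfl : b = 1 - a := by linarith
    have hab : 0 < a * (1 - a) := mul_pos ha hb
    refine le_of_mul_le_mul_left ?_ hab
    nlinarith [mul_nonneg ha.le hX, mul_nonneg hb.le hY]
  rw [← key, ← add_smul, hab, one_smul]

theorem conjStarAlgAut_diagonal_mem_boundedSlice (U : unitaryGroup m ℝ) {d : m → ℝ} {c : ℝ}
    (h₀ : ∀ i, 0 ≤ d i) (h₁ : ∀ i, d i ≤ 1) (hc : ∑ i, d i = c) :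
    conjStarAlgAut ℝ _ U (diagonal d) ∈ boundedSlice m c := by
  have hpos (e : m → ℝ) (he : ∀ i, 0 ≤ e i) :
      (conjStarAlgAut ℝ _ U (diagonal e)).PosSemidef := by
    rw [conjStarAlgAut_apply]
    exact (PosSemidef.diagonal he).mul_mul_conjTranspose_same _
  have hd := hpos d h₀
  refine ⟨?_, hd, ?_, ?_⟩
  · have := hd.isHermitian
    rwa [IsHermitian, conjTranspose_eq_transpose_of_trivial] at this
  · convert hpos (fun i => 1 - d i) (fun i => sub_nonneg.2 (h₁ i)) using 1
    rw [← map_one (conjStarAlgAut ℝ _ U), ← map_sub, ← diagonal_one, diagonal_sub]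
  · rw [conjStarAlgAut_apply, trace_mul_comm, ← mul_assoc, Unitary.coe_star_mul_self, one_mul,
      trace_diagonal, hc]

theorem exists_ne_mem_Ioo_of_sum_eq_natCast {d : m → ℝ} {k : ℕ} (h₀ : ∀ i, 0 ≤ d i)
    (h₁ : ∀ i, d i ≤ 1) (hk : ∑ i, d i = k) {i : m} (hi : d i ∈ Set.Ioo 0 1) :
    ∃ j ≠ i, d j ∈ Set.Ioo 0 1 := by
  by_contra! H
  have hd (j : m) (hj : j ≠ i) : d j = ((if d j = 1 then 1 else 0 : ℤ) : ℝ) := by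
    split_ifs with h
    · simp [h]
    · by_contra h'
      exact H j hj ⟨(h₀ j).lt_of_ne (by simpa [eq_comm] using h'), (h₁ j).lt_of_ne h⟩
  rw [← Finset.add_sum_erase _ _ (Finset.mem_univ i),
    Finset.sum_congr rfl (fun j hj => hd j (Finset.ne_of_mem_erase hj)), ← Int.cast_sum] at hk
  set z : ℤ := ∑ j ∈ Finset.univ.erase i, if d j = 1 then 1 else 0
  have hz : d i = ((k - z : ℤ) : ℝ) := by push_cast; linarith
  rw [hz] at hi
  obtain ⟨hl, hu⟩ := hi
  norm_cast at hl hu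
  omega

theorem mul_self_eq_of_mem_extremePoints_boundedSlice {A : Matrix m m ℝ} {k : ℕ}
    (hA : A ∈ Set.extremePoints ℝ (boundedSlice m k)) : A * A = A := by
  obtain ⟨⟨-, h₀, h₁, hk⟩, hext⟩ := mem_extremePoints_iff_left.1 hA
  set U := h₀.isHermitian.eigenvectorUnitary
  set d := h₀.isHermitian.eigenvalues
  have hspec : A = conjStarAlgAut ℝ _ U (diagonal d) := h₀.isHermitian.spectral_theorem
  have hd₀ (i : m) : 0 ≤ d i := h₀.eigenvalues_nonneg i
  have hsub : (diagonal (fun i => d i - d i * d i)).PosSemidef := by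
    have h := (h₀.sub_mul_self h₁).conjTranspose_mul_mul_same (U : Matrix m m ℝ)
    have h' : conjStarAlgAut ℝ _ (star U) A = diagonal d :=
      h₀.isHermitian.conjStarAlgAut_star_eigenvectorUnitary
    convert h using 1
    change _ = star (U : Matrix m m ℝ) * _ * _
    rw [← conjStarAlgAut_star_apply (S := ℝ), map_sub, map_mul, h', diagonal_mul_diagonal,
      diagonal_sub]
  have hd₁ (i : m) : d i ≤ 1 := by
    have := posSemidef_diagonal_iff.1 hsub i
    nlinarith [hd₀ i]
  have hsum : ∑ i, d i = k := by
    rw [← hk, h₀.isHermitian.trace_eq_sum_eigenvalues]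
    rfl
  have hproj (i : m) : d i * d i = d i := by
    by_contra hi
    have hi : d i ∈ Set.Ioo 0 1 :=
      ⟨(hd₀ i).lt_of_ne (fun h => hi (by simp [← h])),
        (hd₁ i).lt_of_ne (fun h => hi (by simp [h]))⟩
    obtain ⟨j, hji, hj⟩ := exists_ne_mem_Ioo_of_sum_eq_natCast hd₀ hd₁ hsum hi
    obtain ⟨ε, hε, hlt⟩ := exists_between
      (show 0 < min (min (d i) (1 - d i)) (min (d j) (1 - d j)) by
        simp [hi.1, hi.2, hj.1, hj.2])
    simp only [lt_min_iff] at hlt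
    obtain ⟨⟨hi₀, hi₁⟩, hj₀, hj₁⟩ := hlt
    let p (t : ℝ) : m → ℝ := d + (Pi.single i t - Pi.single j t)
    have hp (t : ℝ) (ht : |t| ≤ ε) :
        conjStarAlgAut ℝ _ U (diagonal (p t)) ∈ boundedSlice m (k : ℝ) := by
      obtain ⟨hl, hu⟩ := abs_le.1 ht
      have hbd (l : m) : 0 ≤ p t l ∧ p t l ≤ 1 := by
        by_cases hli : l = i
        · subst hli
          simp only [p, Pi.add_apply, Pi.sub_apply, Pi.single_eq_same,
            Pi.single_eq_of_ne hji.symm]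
          constructor <;> linarith
        · by_cases hlj : l = j
          · subst hlj
            simp only [p, Pi.add_apply, Pi.sub_apply, Pi.single_eq_same, Pi.single_eq_of_ne hli]
            constructor <;> linarith
          · simpa [p, hli, hlj] using ⟨hd₀ l, hd₁ l⟩
      refine conjStarAlgAut_diagonal_mem_boundedSlice U (fun l => (hbd l).1)
        (fun l => (hbd l).2) ?_
      simp [p, Finset.sum_add_distrib, hsum]
    have hmid : A ∈ openSegment ℝ (conjStarAlgAut ℝ _ U (diagonal (p ε)))
        (conjStarAlgAut ℝ _ U (diagonal (p (-ε)))) := by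
      refine ⟨1 / 2, 1 / 2, by norm_num, by norm_num, by norm_num, ?_⟩
      rw [← map_smul, ← map_smul, ← map_add, hspec, ← diagonal_smul, ← diagonal_smul,
        diagonal_add]
      congr 2
      ext l
      simp only [p, Pi.single_neg, Pi.smul_apply, Pi.add_apply, Pi.sub_apply, Pi.neg_apply,
        smul_eq_mul]
      ring
    have heq := hext _ (hp ε (abs_of_pos hε).le) _ (hp (-ε) (by rw [abs_neg, abs_of_pos hε])) hmid
    have := congrFun (diagonal_injective ((conjStarAlgAut ℝ _ U).injective (heq.trans hspec))) i
    simp [p, Pi.single_eq_of_ne hji.symm, hε.ne'] at this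
  rw [hspec, ← map_mul, diagonal_mul_diagonal]
  simp only [hproj]

end Matrix


/-- The set of extreme points of
`H_k(ℝ^n) = {A symmetric : A ⪰ 0, I - A ⪰ 0, tr A = k}` is exactly the Grassmannian
`G_k(ℝ^n) = {A symmetric : A² = A, tr A = k}`. -/
theorem extremePoints_grassmannian_real (n k : ℕ) (hk : k ≤ n) :
    Set.extremePoints ℝ
        {A : Matrix (Fin n) (Fin n) ℝ |
          A.IsSymm ∧ A.PosSemidef ∧ (1 - A).PosSemidef ∧ A.trace = (k : ℝ)} =
      {A : Matrix (Fin n) (Fin n) ℝ | A.IsSymm ∧ A * A = A ∧ A.trace = (k : ℝ)} := by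
  ext A
  constructor
  · intro hA
    exact ⟨hA.1.1, mul_self_eq_of_mem_extremePoints_boundedSlice hA, hA.1.2.2.2⟩
  · rintro ⟨hs, hA, hk⟩
    exact mem_extremePoints_boundedSlice hs hA hk
end

section
/- Let d, n be integers with d ≥ 2 and n ≥ d, and let R = (r_1, …, r_n) with r_1 ≥ … ≥ r_n ≥ 0. If there exists a strongly off-diagonal symmetric nonnegative d-hypermatrix A of order n whose slice sum with respect to the first index equals r_k for every k ∈ {1,…,n} (i.e., A ∈ N_0(d;R)), then d·r_1 ≤ Σ_{i=1}^n r_i. -/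
/-- `N₀(d; R)`: the set of strongly off-diagonal symmetric nonnegative `d`-hypermatrices
of order `n` whose slice sum with respect to the first index equals `R k` for each `k`. -/
def N0 (d n : ℕ) (hd : 0 < d) (R : Fin n → ℝ) : Set ((Fin d → Fin n) → ℝ) :=
  {A | (∀ i, 0 ≤ A i) ∧
       (∀ (i : Fin d → Fin n) (π : Equiv.Perm (Fin d)), A (i ∘ π) = A i) ∧
       (∀ i : Fin d → Fin n, ¬ Function.Injective i → A i = 0) ∧
       (∀ k : Fin n,
         ∑ i ∈ Finset.univ.filter (fun i : Fin d → Fin n => i ⟨0, hd⟩ = k), A i = R k)}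

/-- By symmetry, the slice sums of `A ∈ N₀(d; R)` with respect to any index are `R`. -/
theorem sum_slice_of_mem_N0 {d n : ℕ} {hd : 0 < d} {R : Fin n → ℝ}
    {A : (Fin d → Fin n) → ℝ} (hA : A ∈ N0 d n hd R) (j : Fin d) (k : Fin n) :
    ∑ i, (if i j = k then A i else 0) = R k := by
  obtain ⟨-, hsymm, -, hsum⟩ := hA
  rw [← hsum k, Finset.sum_filter]
  refine Fintype.sum_equiv ((Equiv.swap ⟨0, hd⟩ j).arrowCongr (Equiv.refl (Fin n))) _ _
    fun i => ?_
  have h : (Equiv.swap ⟨0, hd⟩ j).arrowCongr (Equiv.refl (Fin n)) i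
      = i ∘ Equiv.swap ⟨0, hd⟩ j := by
    ext x
    simp [Equiv.arrowCongr]
  rw [h, hsymm]
  simp

/-- The slice sums of `A ∈ N₀(d; R)` add up to the sum of all entries of `A`. -/
theorem sum_eq_sum_of_mem_N0 {d n : ℕ} {hd : 0 < d} {R : Fin n → ℝ}
    {A : (Fin d → Fin n) → ℝ} (hA : A ∈ N0 d n hd R) : ∑ k, R k = ∑ i, A i := by
  simp_rw [← sum_slice_of_mem_N0 hA ⟨0, hd⟩]
  rw [Finset.sum_comm]
  simp

/-- Every slice sum of `A ∈ N₀(d; R)` is at most a `d`-th of the total, since each index value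
occurs at most once in the position of a nonzero entry. -/
theorem mul_le_sum_of_mem_N0 {d n : ℕ} {hd : 0 < d} {R : Fin n → ℝ}
    {A : (Fin d → Fin n) → ℝ} (hA : A ∈ N0 d n hd R) (k : Fin n) :
    (d : ℝ) * R k ≤ ∑ i, R i := by
  have h : (d : ℝ) * R k = ∑ i, ∑ j, (if i j = k then A i else 0) := by
    rw [Finset.sum_comm]
    simp [sum_slice_of_mem_N0 hA]
  rw [h, sum_eq_sum_of_mem_N0 hA]
  obtain ⟨hnonneg, -, hoff, -⟩ := hA
  refine Finset.sum_le_sum fun i _ => ?_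
  by_cases hi : Function.Injective i
  · rw [← Finset.sum_filter, Finset.sum_const, nsmul_eq_mul]
    have hcard : (Finset.univ.filter fun j => i j = k).card ≤ 1 := by
      refine Finset.card_le_one.2 fun a ha b hb => hi ?_
      rw [(Finset.mem_filter.1 ha).2, (Finset.mem_filter.1 hb).2]
    exact mul_le_of_le_one_left (hnonneg i) (by exact_mod_cast hcard)
  · simp [hoff i hi]

/-- Necessity in Hakimi's theorem for hypermatrices: if `N₀(d; R)` is nonempty,
then `d · r₁ ≤ ∑ᵢ rᵢ`. -/
theorem hakimi_necessary (d n : ℕ) (hd : 2 ≤ d) (hn : d ≤ n) (R : Fin n → ℝ)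
    (hmono : ∀ i j : Fin n, i ≤ j → R j ≤ R i) (hnonneg : ∀ i, 0 ≤ R i)
    (hne : (N0 d n (by omega) R).Nonempty) :
    (d : ℝ) * R ⟨0, by omega⟩ ≤ ∑ i, R i := by
  obtain ⟨A, hA⟩ := hne
  exact mul_le_sum_of_mem_N0 hA _
end

section
/- Let d, n be integers with d ≥ 2 and n ≥ d, and let R = (r_1, …, r_n) with r_1 ≥ … ≥ r_n ≥ 0. If d·r_1 ≤ Σ_{i=1}^n r_i, then there exists a strongly off-diagonal symmetric nonnegative d-hypermatrix A of order n whose slice sum with respect to the first index equals r_k for every k ∈ {1,…,n} (i.e., N_0(d;R) is nonempty). -/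
/-- The consecutive half-open intervals between values of `S : ℕ → ℝ` cover `[S 0, S N)`. -/
lemma exists_mem_Ico_succ (S : ℕ → ℝ) (N : ℕ) (x : ℝ) (hx : x ∈ Set.Ico (S 0) (S N)) :
    ∃ m : Fin N, x ∈ Set.Ico (S m) (S (m + 1)) := by
  induction N with
  | zero => exact absurd (hx.1.trans_lt hx.2) (lt_irrefl _)
  | succ N ih =>
    by_cases h : x < S N
    · obtain ⟨m, hm⟩ := ih ⟨hx.1, h⟩
      exact ⟨m.castSucc, hm⟩
    · exact ⟨Fin.last N, not_lt.mp h, hx.2⟩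

/-- The consecutive half-open intervals between values of a monotone sequence are disjoint. -/
lemma eq_of_mem_Ico_succ {S : ℕ → ℝ} (hS : Monotone S) {x : ℝ} {a b : ℕ}
    (ha : x ∈ Set.Ico (S a) (S (a + 1))) (hb : x ∈ Set.Ico (S b) (S (b + 1))) : a = b := by
  by_contra hab
  exact Set.disjoint_left.mp (hS.pairwise_disjoint_on_Ico_succ hab) ha hb

/-- A nonnegative function on `d`-tuples that vanishes on non-injective tuples can be symmetrized;
the slice sum of the result is the total of the slice sums over all `d` positions. -/
lemma N0_nonempty_of_sum_slices {d n : ℕ} (hd : 0 < d) (R : Fin n → ℝ)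
    (B : (Fin d → Fin n) → ℝ) (hB : ∀ i, 0 ≤ B i)
    (hinj : ∀ i, ¬ Function.Injective i → B i = 0)
    (hsum : ∀ k, ∑ j, ∑ i : Fin d → Fin n with i j = k, B i = R k) :
    (N0 d n hd R).Nonempty := by
  have hd' : (d : ℝ) ≠ 0 := by positivity
  have hf : (d.factorial : ℝ) ≠ 0 := by positivity
  set C : (Fin d → Fin n) → ℝ := fun i => ∑ σ : Equiv.Perm (Fin d), B (i ∘ σ) with hC
  have hCsymm : ∀ i (π : Equiv.Perm (Fin d)), C (i ∘ π) = C i := fun i π =>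
    Fintype.sum_equiv (Equiv.mulLeft π) _ _ fun σ => rfl
  have shift : ∀ (D : (Fin d → Fin n) → ℝ) (σ : Equiv.Perm (Fin d)) (j : Fin d) (k : Fin n),
      ∑ i : Fin d → Fin n with i (σ j) = k, D (i ∘ σ) = ∑ i : Fin d → Fin n with i j = k, D i := by
    intro D σ j k
    simp only [Finset.sum_filter]
    exact Fintype.sum_equiv (σ.symm.arrowCongr (Equiv.refl _)) _ _ fun i => by
      simp [Equiv.arrowCongr, Function.comp_def]
  have hCpos : ∀ (j : Fin d) (k : Fin n), ∑ i : Fin d → Fin n with i j = k, C i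
      = ∑ i : Fin d → Fin n with i ⟨0, hd⟩ = k, C i := by
    intro j k
    rw [← shift C (Equiv.swap ⟨0, hd⟩ j) ⟨0, hd⟩ k]
    simp only [hCsymm, Equiv.swap_apply_left]
  have hCtot : ∀ k, ∑ j, ∑ i : Fin d → Fin n with i j = k, C i = d.factorial * R k := by
    intro k
    have : ∀ σ : Equiv.Perm (Fin d),
        ∑ j, ∑ i : Fin d → Fin n with i j = k, B (i ∘ σ) = R k := by
      intro σ
      rw [← hsum k, ← Equiv.sum_comp σ]
      exact Finset.sum_congr rfl fun j _ => shift B σ j k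
    calc ∑ j, ∑ i : Fin d → Fin n with i j = k, C i
        = ∑ j, ∑ σ : Equiv.Perm (Fin d), ∑ i : Fin d → Fin n with i j = k, B (i ∘ σ) :=
          Finset.sum_congr rfl fun j _ => Finset.sum_comm
      _ = ∑ σ : Equiv.Perm (Fin d), ∑ j, ∑ i : Fin d → Fin n with i j = k, B (i ∘ σ) :=
          Finset.sum_comm
      _ = d.factorial * R k := by simp [this, Fintype.card_perm]
  refine ⟨fun i => d / d.factorial * C i, fun i => ?_, fun i π => ?_, fun i hi => ?_, fun k => ?_⟩
  · exact mul_nonneg (by positivity) (Finset.sum_nonneg fun σ _ => hB _)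
  · simp only [hCsymm]
  · have : C i = 0 := Finset.sum_eq_zero fun σ _ => hinj _ fun h =>
      hi ((σ.injective_comp i).mp h)
    simp [this]
  · have h := hCtot k
    simp only [hCpos, Finset.sum_const, Finset.card_univ, Fintype.card_fin, nsmul_eq_mul] at h
    rw [← Finset.mul_sum, div_mul_eq_mul_div, h]
    field_simp

open MeasureTheory in
/-- Sufficiency in Hakimi's theorem for hypermatrices: if `d · r₁ ≤ ∑ᵢ rᵢ`,
then `N₀(d; R)` is nonempty. -/
theorem hakimi_sufficient (d n : ℕ) (hd : 2 ≤ d) (hn : d ≤ n) (R : Fin n → ℝ)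
    (hmono : ∀ i j : Fin n, i ≤ j → R j ≤ R i) (hnonneg : ∀ i, 0 ≤ R i)
    (hcond : (d : ℝ) * R ⟨0, by omega⟩ ≤ ∑ i, R i) :
    (N0 d n (by omega) R).Nonempty := by
  have hd0 : (0 : ℝ) < d := by positivity
  -- Lay intervals of lengths `R k` end to end, and fold the resulting segment into `d` layers of
  -- length `T`; each point `t` of `[0, T)` then selects `d` distinct intervals.
  obtain ⟨T, hT⟩ : ∃ T, d * T = ∑ i, R i := ⟨(∑ i, R i) / d, by field_simp⟩
  have hRT : ∀ k, R k ≤ T := fun k =>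
    (hmono ⟨0, by omega⟩ k (Fin.mk_le_mk.mpr (Nat.zero_le _))).trans
      (le_of_mul_le_mul_left (hcond.trans_eq hT.symm) hd0)
  have hT0 : 0 ≤ T := (hnonneg ⟨0, by omega⟩).trans (hRT _)
  set S : ℕ → ℝ := fun m => ∑ i ∈ Finset.range m, if h : i < n then R ⟨i, h⟩ else 0 with hS
  have hSmono : Monotone S := monotone_nat_of_le_succ fun m => by
    simp only [hS, Finset.sum_range_succ]
    split_ifs <;> simp [hnonneg]
  have hS0 : S 0 = 0 := by simp [hS]
  have hSn : S n = d * T := by simp [hS, hT, Finset.sum_range]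
  have hSsucc : ∀ k : Fin n, S (k + 1) = S k + R k := fun k => by
    simp [hS, Finset.sum_range_succ]
  have hLmono : Monotone fun j : ℕ => (j : ℝ) * T := fun a b hab => by
    dsimp only; gcongr
  set E : (Fin d → Fin n) → Set ℝ := fun i =>
    {t | t ∈ Set.Ico 0 T ∧ ∀ j : Fin d, t + j * T ∈ Set.Ico (S (i j)) (S (i j + 1))} with hE
  have hslice_meas : ∀ (j : Fin d) (k : Fin n),
      MeasurableSet {t | t + j * T ∈ Set.Ico (S k) (S (k + 1))} := fun j k =>
    (measurable_id.add_const _) measurableSet_Ico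
  have hE_meas : ∀ i, MeasurableSet (E i) := fun i => by
    have : E i = Set.Ico 0 T ∩ ⋂ j : Fin d, {t | t + j * T ∈ Set.Ico (S (i j)) (S (i j + 1))} := by
      ext t; simp [hE]
    rw [this]
    exact measurableSet_Ico.inter (MeasurableSet.iInter fun j => hslice_meas j _)
  have hE_fin : ∀ i, volume (E i) ≠ ⊤ := fun i =>
    ((measure_mono fun t ht => ht.1).trans_lt (measure_Ico_lt_top (a := (0 : ℝ)) (b := T))).ne
  have hE_disj : Pairwise fun i i' => Disjoint (E i) (E i') := fun i i' hne =>
    Set.disjoint_left.mpr fun t ht ht' => hne <| funext fun j =>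
      Fin.ext (eq_of_mem_Ico_succ hSmono (ht.2 j) (ht'.2 j))
  refine N0_nonempty_of_sum_slices _ R (fun i => volume.real (E i)) (fun i => measureReal_nonneg)
    (fun i hi => ?_) (fun k => ?_)
  · suffices E i = ∅ by simp [this]
    refine Set.eq_empty_of_forall_notMem fun t ht => hi fun a b hab => ?_
    have key : ∀ a b : Fin d, i a = i b → ¬ a < b := by
      intro a b hab hlt
      have h1 := (ht.2 a).1
      have h2 := (ht.2 b).2
      rw [← hab, hSsucc] at h2
      have h3 : ((a : ℕ) : ℝ) + 1 ≤ (b : ℕ) := by exact_mod_cast hlt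
      nlinarith [hRT (i a), mul_le_mul_of_nonneg_right h3 hT0]
    exact le_antisymm (not_lt.mp (key b a hab.symm)) (not_lt.mp (key a b hab))
  · have hlayer : ∀ j : Fin d, ∑ i : Fin d → Fin n with i j = k, volume.real (E i)
        = volume.real (Set.Ico (j * T) ((j + 1 : ℕ) * T) ∩ Set.Ico (S k) (S (k + 1))) := by
      intro j
      rw [← measureReal_biUnion_finset (fun i _ i' _ h => hE_disj h) (fun i _ => hE_meas i)
        (fun i _ => hE_fin i)]
      have : (⋃ i ∈ Finset.univ.filter (fun i : Fin d → Fin n => i j = k), E i)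
          = (fun t => t + j * T) ⁻¹'
            (Set.Ico (j * T) ((j + 1 : ℕ) * T) ∩ Set.Ico (S k) (S (k + 1))) := by
        ext t
        simp only [Finset.mem_filter_univ, Set.mem_iUnion, exists_prop, Set.mem_preimage,
          Set.mem_inter_iff]
        have hIco : t + j * T ∈ Set.Ico ((j : ℕ) * T) ((j + 1 : ℕ) * T) ↔ t ∈ Set.Ico 0 T := by
          push_cast
          constructor <;> rintro ⟨h1, h2⟩ <;> constructor <;> linarith
        rw [hIco]
        constructor
        · rintro ⟨i, rfl, ht⟩
          exact ⟨ht.1, ht.2 j⟩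
        · rintro ⟨ht, htk⟩
          have hex : ∀ l : Fin d, ∃ m : Fin n, t + l * T ∈ Set.Ico (S m) (S (m + 1)) := by
            intro l
            refine exists_mem_Ico_succ S n _ ⟨?_, ?_⟩
            · rw [hS0]
              have := ht.1
              positivity
            · have h3 : ((l : ℕ) : ℝ) + 1 ≤ d := by exact_mod_cast l.2
              rw [hSn]
              nlinarith [ht.2, mul_le_mul_of_nonneg_right h3 hT0]
          choose i hi using hex
          exact ⟨i, Fin.ext (eq_of_mem_Ico_succ hSmono (hi j) htk), ht, hi⟩
      rw [this, measureReal_def, measure_preimage_add_right, measureReal_def]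
    simp only [hlayer]
    rw [← measureReal_iUnion_fintype ?_ ?_ fun j => measure_inter_ne_top_of_right_ne_top
      measure_Ico_lt_top.ne]
    · have : (⋃ j : Fin d, Set.Ico ((j : ℕ) * T) ((j + 1 : ℕ) * T) ∩ Set.Ico (S k) (S (k + 1)))
          = Set.Ico (S k) (S (k + 1)) := by
        rw [← Set.iUnion_inter, Set.inter_eq_right]
        intro x hx
        have h0 := hSmono (Nat.zero_le k)
        have h1 := hSmono k.2
        rw [hS0] at h0
        rw [hSn] at h1
        exact Set.mem_iUnion.mpr (exists_mem_Ico_succ (fun j : ℕ => (j : ℝ) * T) d x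
          ⟨by simpa using h0.trans hx.1, hx.2.trans_le h1⟩)
      rw [this, hSsucc, Real.volume_real_Ico_of_le (by linarith [hnonneg k])]
      ring
    · intro a b hab
      exact (hLmono.pairwise_disjoint_on_Ico_succ (Fin.val_ne_of_ne hab)).mono
        Set.inter_subset_left Set.inter_subset_left
    · exact fun j => measurableSet_Ico.inter measurableSet_Ico
end

section
/- Let d, n be integers with d ≥ 2 and n ≥ d, and let R = (r_1, …, r_n) with r_1 ≥ … ≥ r_n ≥ 0 and d·r_1 ≤ Σ_{i=1}^n r_i. Then there exists an element A of N_0(d;R) whose number of nonzero entries (i.e., the number of tuples (i_1,…,i_d) ∈ {1,…,n}^d with A(i_1,…,i_d) ≠ 0) is at most n · d!. -/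
/-- Summing over all permutations a function of the preimage of `0`. -/
lemma sum_perm_symm_zero (m : ℕ) (g : Fin (m + 1) → ℝ) :
    ∑ π : Equiv.Perm (Fin (m + 1)), g (π.symm 0) = (m.factorial : ℝ) * ∑ j, g j := by
  rw [show ∑ π : Equiv.Perm (Fin (m + 1)), g (π.symm 0) = ∑ π : Equiv.Perm (Fin (m + 1)), g (π 0)
    from Equiv.sum_comp (Equiv.inv (Equiv.Perm (Fin (m + 1))))
      (fun π : Equiv.Perm (Fin (m + 1)) => g (π 0)), ← Equiv.sum_comp Equiv.Perm.decomposeFin.symm, Fintype.sum_prod_type]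
  simp [Fintype.card_perm, Finset.mul_sum]

/-- A vector with coordinates in `[0, t]` and total `d * t` has either no coordinate or at least two
coordinates strictly between `0` and `t`. -/
lemma card_strict_ne_one (d n : ℕ) (t : ℝ) (r : Fin n → ℝ)
    (h0 : ∀ i, 0 ≤ r i) (h1 : ∀ i, r i ≤ t) (hs : ∑ i, r i = d * t) :
    (Finset.univ.filter (fun i => 0 < r i ∧ r i < t)).card ≠ 1 := by
  intro h
  obtain ⟨a, ha⟩ := Finset.card_eq_one.mp h
  have hm : 0 < r a ∧ r a < t := by
    have : a ∈ Finset.univ.filter (fun i => 0 < r i ∧ r i < t) := by simp [ha]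
    simpa using this
  have hother : ∀ i ∈ Finset.univ.erase a, r i = if r i = t then t else 0 := by
    intro i hi
    split_ifs with hit
    · exact hit
    · by_contra hne
      have : i ∈ Finset.univ.filter (fun i => 0 < r i ∧ r i < t) := by
        simpa using ⟨lt_of_le_of_ne (h0 i) (Ne.symm hne), lt_of_le_of_ne (h1 i) hit⟩
      rw [ha] at this
      simp_all
  rw [← Finset.add_sum_erase _ _ (Finset.mem_univ a), Finset.sum_congr rfl hother,
    ← Finset.sum_filter, Finset.sum_const, nsmul_eq_mul] at hs
  generalize (Finset.card _) = c at hs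
  have htpos : 0 < t := hm.1.trans hm.2
  have hlt : (c : ℝ) < d := by nlinarith
  have hgt : (d : ℝ) < c + 1 := by nlinarith
  have hlt' : c < d := by exact_mod_cast hlt
  have hgt' : d < c + 1 := by exact_mod_cast hgt
  omega

/-- A set of `d` indices that contains every maximal coordinate and only positive ones. -/
lemma exists_card_eq_between (d n : ℕ) (t : ℝ) (ht : 0 < t) (r : Fin n → ℝ)
    (h0 : ∀ i, 0 ≤ r i) (h1 : ∀ i, r i ≤ t) (hs : ∑ i, r i = d * t) :
    ∃ S : Finset (Fin n), S.card = d ∧ (∀ i ∈ S, 0 < r i) ∧ ∀ i ∉ S, r i < t := by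
  have hT : (Finset.univ.filter (fun i => r i = t)).card ≤ d := by
    have : ∑ i ∈ Finset.univ.filter (fun i => r i = t), t ≤ d * t := by
      rw [← hs, Finset.sum_filter]
      refine Finset.sum_le_sum fun i _ => ?_
      split_ifs with h
      · exact h.ge
      · exact h0 i
    rw [Finset.sum_const, nsmul_eq_mul] at this
    exact_mod_cast le_of_mul_le_mul_right this ht
  have hP : d ≤ (Finset.univ.filter (fun i => 0 < r i)).card := by
    have : d * t ≤ ∑ i ∈ Finset.univ.filter (fun i => 0 < r i), t := by
      rw [← hs, Finset.sum_filter]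
      refine Finset.sum_le_sum fun i _ => ?_
      split_ifs with h
      · exact h1 i
      · exact not_lt.mp h
    rw [Finset.sum_const, nsmul_eq_mul] at this
    exact_mod_cast le_of_mul_le_mul_right this ht
  have hTP : Finset.univ.filter (fun i => r i = t) ⊆ Finset.univ.filter (fun i => 0 < r i) := by
    intro i hi
    simp only [Finset.mem_filter, Finset.mem_univ, true_and] at hi ⊢
    rwa [hi]
  obtain ⟨S, hTS, hSP, hS⟩ := Finset.exists_subsuperset_card_eq hTP hT hP
  refine ⟨S, hS, fun i hi => by simpa using hSP hi, fun i hi => ?_⟩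
  refine lt_of_le_of_ne (h1 i) fun h => hi (hTS ?_)
  simpa using h

/-- The amount that can be subtracted from `r` on `S` and from the bound `t`, exhausting some
coordinate. -/
lemma exists_max_step (n : ℕ) (t : ℝ) (r : Fin n → ℝ) (S : Finset (Fin n)) (hS : S.Nonempty)
    (hpos : ∀ i ∈ S, 0 < r i) (hlt : ∀ i ∉ S, r i < t) :
    ∃ ε : ℝ, 0 < ε ∧ (∀ i ∈ S, ε ≤ r i) ∧ (∀ i ∉ S, r i ≤ t - ε) ∧
      ∃ a, (a ∈ S ∧ r a = ε) ∨ (a ∉ S ∧ r a = t - ε) := by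
  have hne : (Finset.univ : Finset (Fin n)).Nonempty := ⟨hS.choose, Finset.mem_univ _⟩
  obtain ⟨a, -, ha⟩ := Finset.exists_min_image Finset.univ
    (fun i => if i ∈ S then r i else t - r i) hne
  refine ⟨if a ∈ S then r a else t - r a, ?_, fun i hi => ?_, fun i hi => ?_, a, ?_⟩
  · split_ifs with h
    · exact hpos a h
    · exact sub_pos.mpr (hlt a h)
  · simpa only [if_pos hi] using ha i (Finset.mem_univ i)
  · have := ha i (Finset.mem_univ i)
    simp only [if_neg hi] at this
    linarith
  · by_cases h : a ∈ S
    · simp [h]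
    · simp [h]

/-- Each value of `S` is attained once by its increasing enumeration. -/
lemma sum_orderEmbOfFin_ite (d n : ℕ) (S : Finset (Fin n)) (hS : S.card = d) (k : Fin n) (x : ℝ) :
    ∑ j, (if S.orderEmbOfFin hS j = k then x else 0) = if k ∈ S then x else 0 := by
  by_cases hk : k ∈ S
  · obtain ⟨j, rfl⟩ : k ∈ Set.range (S.orderEmbOfFin hS) := by
      rw [Finset.range_orderEmbOfFin]; exact hk
    simp
  · rw [if_neg hk]
    refine Finset.sum_eq_zero fun j _ => if_neg ?_
    rintro rfl
    exact hk (Finset.orderEmbOfFin_mem S hS j)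

/-- The sum over all tuples through `k` of a weight concentrated on the enumeration of `S`. -/
lemma sum_single_orderEmbOfFin (d n : ℕ) (S : Finset (Fin n)) (hS : S.card = d) (k : Fin n)
    (x : ℝ) :
    ∑ f : Fin d → Fin n, ∑ j, (if f j = k then
      (Pi.single (⇑(S.orderEmbOfFin hS)) x : (Fin d → Fin n) → ℝ) f else 0)
      = if k ∈ S then x else 0 := by
  rw [Finset.sum_eq_single (⇑(S.orderEmbOfFin hS))]
  · simpa using sum_orderEmbOfFin_ite d n S hS k x
  · intro f _ hf
    simp [Pi.single_eq_of_ne hf]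
  · simp

/-- A vector with coordinates in `[0, t]` and total `d * t` is a nonnegative combination of
indicator vectors of injective `d`-tuples; the number of tuples used is at most the number of
coordinates strictly between `0` and `t`, or one. -/
lemma exists_sparse_decomposition (d n : ℕ) (hd : 0 < d) (t : ℝ) (r : Fin n → ℝ)
    (h0 : ∀ i, 0 ≤ r i) (h1 : ∀ i, r i ≤ t) (hs : ∑ i, r i = d * t) :
    ∃ w : (Fin d → Fin n) → ℝ, (∀ f, 0 ≤ w f) ∧ (∀ f, ¬ Function.Injective f → w f = 0) ∧
      (∀ k, ∑ f, ∑ j, (if f j = k then w f else 0) = r k) ∧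
      (Finset.univ.filter (fun f => w f ≠ 0)).card ≤
        max 1 (Finset.univ.filter (fun i => 0 < r i ∧ r i < t)).card := by
  induction hm : (Finset.univ.filter (fun i => 0 < r i ∧ r i < t)).card
    using Nat.strong_induction_on generalizing t r with
  | _ m ih =>
  by_cases hr : ∀ i, r i = 0
  · exact ⟨0, by simp, by simp, by simp [hr], by simp⟩
  have ht : 0 < t := by
    push Not at hr
    obtain ⟨i, hi⟩ := hr
    exact ((h0 i).lt_of_ne hi.symm).trans_le (h1 i)
  obtain ⟨S, hS, hpos, hlt⟩ := exists_card_eq_between d n t ht r h0 h1 hs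
  have hSne : S.Nonempty := Finset.card_pos.mp (hS ▸ hd)
  obtain ⟨ε, hε, hεS, hεS', a, ha⟩ := exists_max_step n t r S hSne hpos hlt
  set e : Fin d → Fin n := ⇑(S.orderEmbOfFin hS) with he
  have heinj : Function.Injective e := (S.orderEmbOfFin hS).injective
  have hεt : ε ≤ t := (hεS _ hSne.choose_spec).trans (h1 _)
  rcases hεt.eq_or_lt with rfl | hεt
  · refine ⟨Pi.single e ε, fun f => ?_, fun f hf => ?_, fun k => ?_, ?_⟩
    · by_cases h : f = e
      · subst h; simpa using hε.le
      · simp [Pi.single_eq_of_ne h]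
    · exact Pi.single_eq_of_ne (by rintro rfl; exact hf heinj) _
    · rw [sum_single_orderEmbOfFin]
      split_ifs with h
      · exact le_antisymm (hεS k h) (h1 k)
      · have := hεS' k h
        exact le_antisymm (h0 k) (by linarith)
    · refine le_trans ?_ (le_max_left _ _)
      refine (Finset.card_le_card (t := {e}) fun f hf => ?_).trans (by simp)
      by_contra h
      rw [Finset.mem_singleton] at h
      exact (Finset.mem_filter.mp hf).2 (by simp [Pi.single_eq_of_ne h])
  · let r' : Fin n → ℝ := fun i => r i - if i ∈ S then ε else 0
    have hr' : ∀ i, r' i = r i - if i ∈ S then ε else 0 := fun _ => rfl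
    have hsub : Finset.univ.filter (fun i => 0 < r' i ∧ r' i < t - ε) ⊂
        Finset.univ.filter (fun i => 0 < r i ∧ r i < t) := by
      refine (Finset.ssubset_iff_of_subset fun i hi => ?_).mpr ⟨a, ?_, ?_⟩
      · simp only [Finset.mem_filter, Finset.mem_univ, true_and, hr'] at hi ⊢
        split_ifs at hi <;> constructor <;> linarith
      · rw [Finset.mem_filter]
        rcases ha with ⟨-, ha⟩ | ⟨-, ha⟩ <;> refine ⟨Finset.mem_univ _, ?_, ?_⟩ <;> linarith
      · rcases ha with ⟨haS, ha⟩ | ⟨haS, ha⟩ <;> simp [hr', haS, ha]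
    have hcard := Finset.card_lt_card hsub
    have hne := card_strict_ne_one d n t r h0 h1 hs
    rw [hm] at hcard hne
    obtain ⟨w, hw0, hwinj, hwsum, hwcard⟩ := ih _ hcard (t - ε) r'
      (fun i => by
        rw [hr']; split_ifs with h
        · linarith [hεS i h]
        · linarith [h0 i])
      (fun i => by
        rw [hr']; split_ifs with h
        · linarith [h1 i]
        · linarith [hεS' i h])
      (by simp [hr', hs, hS]; ring) rfl
    refine ⟨w + Pi.single e ε, fun f => ?_, fun f hf => ?_, fun k => ?_, ?_⟩
    · refine add_nonneg (hw0 f) ?_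
      by_cases h : f = e
      · subst h; simpa using hε.le
      · simp [Pi.single_eq_of_ne h]
    · have : f ≠ e := by rintro rfl; exact hf heinj
      simp [hwinj f hf, Pi.single_eq_of_ne this]
    · have := sum_single_orderEmbOfFin d n S hS k ε
      rw [← he] at this
      simp only [Pi.add_apply, ite_add_zero, Finset.sum_add_distrib]
      rw [hwsum, this, hr']
      ring
    · have : (Finset.univ.filter (fun f =>
          (w + Pi.single e ε : (Fin d → Fin n) → ℝ) f ≠ 0)) ⊆
          insert e (Finset.univ.filter (fun f => w f ≠ 0)) := by
        intro f hf
        rw [Finset.mem_insert, Finset.mem_filter]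
        by_contra h
        push Not at h
        rw [Finset.mem_filter] at hf
        exact hf.2 (by simp [Pi.single_eq_of_ne h.1, h.2 (Finset.mem_univ _)])
      have := (Finset.card_le_card this).trans (Finset.card_insert_le _ _)
      omega

/-- If `d · r₁ ≤ ∑ᵢ rᵢ`, then `N₀(d; R)` contains a hypermatrix with at most
`n · d!` nonzero entries. -/
theorem hakimi_sparse (d n : ℕ) (hd : 2 ≤ d) (hn : d ≤ n) (R : Fin n → ℝ)
    (hmono : ∀ i j : Fin n, i ≤ j → R j ≤ R i) (hnonneg : ∀ i, 0 ≤ R i)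
    (hcond : (d : ℝ) * R ⟨0, by omega⟩ ≤ ∑ i, R i) :
    ∃ A ∈ N0 d n (by omega : 0 < d) R,
      (Finset.univ.filter (fun i : Fin d → Fin n => A i ≠ 0)).card ≤ n * Nat.factorial d := by
  obtain ⟨m, rfl⟩ : ∃ m, d = m + 1 := ⟨d - 1, by omega⟩
  have hdpos : (0 : ℝ) < ((m + 1 : ℕ) : ℝ) := by positivity
  have hfac : (0 : ℝ) < (m.factorial : ℝ) := by exact_mod_cast m.factorial_pos
  obtain ⟨w, hw0, hwinj, hwsum, hwcard⟩ := exists_sparse_decomposition (m + 1) n (by omega)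
    ((∑ i, R i) / (m + 1 : ℕ)) R hnonneg
    (fun i => by
      rw [le_div_iff₀ hdpos, mul_comm]
      exact (mul_le_mul_of_nonneg_left (hmono _ i (Fin.mk_le_of_le_val (Nat.zero_le _)))
        hdpos.le).trans hcond)
    (by field_simp)
  refine ⟨fun i => (∑ π : Equiv.Perm (Fin (m + 1)), w (i ∘ π)) / m.factorial,
    ⟨fun i => div_nonneg (Finset.sum_nonneg fun π _ => hw0 _) hfac.le, fun i σ => ?_,
      fun i hi => ?_, fun k => ?_⟩, ?_⟩
  · exact congrArg (· / (m.factorial : ℝ))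
      (Equiv.sum_comp (Equiv.mulLeft σ) (fun π : Equiv.Perm (Fin (m + 1)) => w (i ∘ π)))
  · dsimp only
    rw [Finset.sum_eq_zero, zero_div]
    intro π _
    exact hwinj _ fun h => hi ((Equiv.injective_comp π i).mp h)
  · rw [← Finset.sum_div, div_eq_iff hfac.ne', Finset.sum_comm]
    have key : ∀ π : Equiv.Perm (Fin (m + 1)),
        ∑ i ∈ Finset.univ.filter (fun i : Fin (m + 1) → Fin n => i 0 = k), w (i ∘ π) =
          ∑ f : Fin (m + 1) → Fin n, if f (π.symm 0) = k then w f else 0 := by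
      intro π
      rw [Finset.sum_filter, ← Equiv.sum_comp (Equiv.arrowCongr π (Equiv.refl (Fin n)))]
      simp [Equiv.arrowCongr, Function.comp_def]
    refine (Finset.sum_congr rfl fun π _ => key π).trans ?_
    rw [Finset.sum_comm, ← hwsum k, mul_comm, Finset.mul_sum]
    exact Finset.sum_congr rfl fun f _ =>
      sum_perm_symm_zero m (fun j => if f j = k then w f else 0)
  · have hsub : Finset.univ.filter (fun i : Fin (m + 1) → Fin n =>
        (∑ π : Equiv.Perm (Fin (m + 1)), w (i ∘ π)) / m.factorial ≠ 0) ⊆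
        (Finset.univ.filter (fun f => w f ≠ 0) ×ˢ
          (Finset.univ : Finset (Equiv.Perm (Fin (m + 1))))).image (fun p => p.1 ∘ p.2) := by
      intro i hi
      rw [Finset.mem_filter] at hi
      have hne : ∑ π : Equiv.Perm (Fin (m + 1)), w (i ∘ π) ≠ 0 := fun h => hi.2 (by simp [h])
      obtain ⟨π, -, hπ⟩ := Finset.exists_ne_zero_of_sum_ne_zero hne
      refine Finset.mem_image.mpr ⟨(i ∘ π, π.symm), by simpa using hπ, ?_⟩
      funext x
      simp
    refine (Finset.card_le_card hsub).trans (Finset.card_image_le.trans ?_)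
    rw [Finset.card_product, Finset.card_univ, Fintype.card_perm, Fintype.card_fin]
    refine Nat.mul_le_mul_right _ (hwcard.trans (max_le (by omega) ?_))
    exact (Finset.card_filter_le _ _).trans (by simp)
end

section
/- Let d ≥ 2 and n = d, and let R = (r_1, …, r_d) with r_1 ≥ … ≥ r_d ≥ 0. If N_0(d;R) is nonempty, then r_1 = r_2 = … = r_d, and N_0(d;R) consists of exactly one element, namely the d-hypermatrix A with A(i_1,…,i_d) = r_1/(d−1)! whenever (i_1,…,i_d) is a permutation of (1,2,…,d) and A(i_1,…,i_d) = 0 otherwise. -/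
/-- The number of permutations of `Fin (m + 1)` sending `0` to a given element is `m!`. -/
theorem card_perm_zero_eq (m : ℕ) (k : Fin (m + 1)) :
    (Finset.univ.filter (fun σ : Equiv.Perm (Fin (m + 1)) => σ 0 = k)).card
      = Nat.factorial m := by
  rw [Finset.card_filter, ← Equiv.sum_comp Equiv.Perm.decomposeFin.symm, Fintype.sum_prod_type]
  simp [Fintype.card_perm]

/-- The number of injective self-maps of `Fin d` with a prescribed value at `0` is `(d - 1)!`. -/
theorem card_injective_zero_eq (d : ℕ) (hd : 0 < d) (k : Fin d) :
    (Finset.univ.filter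
      (fun i : Fin d → Fin d => i ⟨0, hd⟩ = k ∧ Function.Injective i)).card
      = Nat.factorial (d - 1) := by
  obtain ⟨m, rfl⟩ : ∃ m, d = m + 1 := ⟨d - 1, by omega⟩
  rw [Nat.add_sub_cancel, ← card_perm_zero_eq m k]
  symm
  refine Finset.card_bij (fun σ _ => ⇑σ) ?_ ?_ ?_
  · intro σ hσ
    exact Finset.mem_filter.mpr
      ⟨Finset.mem_univ _, (Finset.mem_filter.mp hσ).2, σ.injective⟩
  · intro σ _ τ _ h
    exact DFunLike.coe_injective h
  · intro i hi
    obtain ⟨h0, hinj⟩ := (Finset.mem_filter.mp hi).2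
    exact ⟨Equiv.ofBijective i (Finite.injective_iff_bijective.mp hinj),
      by simpa using h0, rfl⟩

/-- The slice sums of a function that is constant on injective tuples and zero elsewhere. -/
theorem sum_slice_ite_injective (d : ℕ) (hd : 0 < d) (k : Fin d) (c : ℝ) :
    ∑ i ∈ Finset.univ.filter (fun i : Fin d → Fin d => i ⟨0, hd⟩ = k),
      (if Function.Injective i then c else 0) = Nat.factorial (d - 1) * c := by
  rw [← Finset.sum_filter, Finset.filter_filter, Finset.sum_const,
    card_injective_zero_eq d hd k, nsmul_eq_mul]

/-- A member of `N₀(d; R)` of order `d` is determined by its entry at the identity tuple. -/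
theorem N0_eq_ite_injective {d : ℕ} {hd : 0 < d} {R : Fin d → ℝ}
    {A : (Fin d → Fin d) → ℝ} (hA : A ∈ N0 d d hd R) :
    A = fun i => if Function.Injective i then A id else 0 := by
  obtain ⟨-, hsymm, hoff, -⟩ := hA
  funext i
  split_ifs with hi
  · exact hsymm id (Equiv.ofBijective i (Finite.injective_iff_bijective.mp hi))
  · exact hoff i hi

/-- Every slice sum of a member of `N₀(d; R)` of order `d` is `(d - 1)!` times its entry at the
identity tuple. -/
theorem N0_slice_sum_eq {d : ℕ} {hd : 0 < d} {R : Fin d → ℝ}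
    {A : (Fin d → Fin d) → ℝ} (hA : A ∈ N0 d d hd R) (k : Fin d) :
    R k = Nat.factorial (d - 1) * A id := by
  rw [← hA.2.2.2 k, ← sum_slice_ite_injective d hd k]
  exact Finset.sum_congr rfl fun i _ => congrFun (N0_eq_ite_injective hA) i

/-- Case `n = d`: if `N₀(d; R)` is nonempty, then `r₁ = ⋯ = r_d` and `N₀(d; R)` is the
singleton consisting of the hypermatrix equal to `r₁/(d-1)!` on tuples that are
permutations of `(1, …, d)` (i.e. injective tuples) and `0` elsewhere. -/
theorem N0_singleton_of_eq (d : ℕ) (hd : 2 ≤ d) (R : Fin d → ℝ)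
    (hmono : ∀ i j : Fin d, i ≤ j → R j ≤ R i) (hnonneg : ∀ i, 0 ≤ R i)
    (hne : (N0 d d (by omega) R).Nonempty) :
    (∀ k : Fin d, R k = R ⟨0, by omega⟩) ∧
      N0 d d (by omega : 0 < d) R =
        {fun i : Fin d → Fin d =>
          if Function.Injective i then R ⟨0, by omega⟩ / (Nat.factorial (d - 1) : ℝ)
          else 0} := by
  have hf : (Nat.factorial (d - 1) : ℝ) ≠ 0 := by positivity
  have key : ∀ B ∈ N0 d d (by omega : 0 < d) R, B = fun i : Fin d → Fin d =>
      if Function.Injective i then R ⟨0, by omega⟩ / (Nat.factorial (d - 1) : ℝ) else 0 := by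
    intro B hB
    rw [N0_slice_sum_eq hB, mul_div_cancel_left₀ _ hf]
    exact N0_eq_ite_injective hB
  obtain ⟨A, hA⟩ := hne
  refine ⟨fun k => by rw [N0_slice_sum_eq hA k, N0_slice_sum_eq hA], ?_⟩
  exact Set.eq_singleton_iff_unique_mem.mpr ⟨key A hA ▸ hA, key⟩
end

section
/- Let d ≥ 2 and n = d + 1, and let R = (r_1, …, r_{d+1}) with r_1 ≥ … ≥ r_{d+1} ≥ 0 and d·r_1 ≤ Σ_{i=1}^{d+1} r_i. Then N_0(d;R) consists of exactly one element A, and for each k ∈ {1,…,d+1}, the common value of A on all tuples (i_1,…,i_d) that enumerate the set {1,…,d+1} \ {k} injectively is (1/d!)·(Σ_{i=1}^{d+1} r_i) − r_k/(d−1)!, and this value is nonnegative; all other entries of A are zero. -/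
/-- An injective map `Fin d → Fin (d + 1)` omits exactly one value `k`, and equals
`k.succAbove` up to a permutation of its arguments. -/
lemma exists_eq_succAbove_comp_perm {d : ℕ} {i : Fin d → Fin (d + 1)}
    (hi : Function.Injective i) :
    ∃ k : Fin (d + 1), ∃ π : Equiv.Perm (Fin d), i = k.succAbove ∘ π := by
  have hs : ¬ Function.Surjective i := fun h => by
    simpa using Fintype.card_le_of_surjective i h
  obtain ⟨k, hk⟩ : ∃ k, ∀ j, i j ≠ k := by
    simpa [Function.Surjective] using hs
  choose p hp using fun j => Fin.exists_succAbove_eq (hk j)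
  have hpinj : Function.Injective p := fun a b hab => hi (by rw [← hp a, ← hp b, hab])
  exact ⟨k, Equiv.ofBijective p (Finite.injective_iff_bijective.1 hpinj),
    funext fun j => (hp j).symm⟩

lemma injective_succAbove_comp_perm (d : ℕ) :
    Function.Injective (fun x : Fin (d + 1) × Equiv.Perm (Fin d) => x.1.succAbove ∘ x.2) := by
  rintro ⟨k, π⟩ ⟨l, σ⟩ h
  have h' : ∀ j, k.succAbove (π j) = l.succAbove (σ j) := fun j => congrFun h j
  have hkl : k = l := by
    by_contra hne
    obtain ⟨j, hj⟩ := Fin.exists_succAbove_eq hne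
    exact Fin.succAbove_ne k (π (σ.symm j)) (by rw [h', Equiv.apply_symm_apply, hj])
  subst hkl
  have : π = σ := Equiv.ext fun j => Fin.succAbove_right_injective (h' j)
  rw [this]

lemma card_perm_apply_zero_eq (e : ℕ) (j : Fin (e + 1)) :
    (Finset.univ.filter fun π : Equiv.Perm (Fin (e + 1)) => π 0 = j).card = e.factorial := by
  have h : (Finset.univ.filter fun π : Equiv.Perm (Fin (e + 1)) => π 0 = j) =
      (Finset.univ : Finset (Equiv.Perm (Fin e))).map
        ⟨fun σ => Equiv.Perm.decomposeFin.symm (j, σ), fun a b h => by simpa using h⟩ := by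
    ext π
    obtain ⟨⟨a, σ⟩, rfl⟩ := Equiv.Perm.decomposeFin.symm.surjective π
    rw [Finset.mem_filter_univ, Equiv.Perm.decomposeFin_symm_apply_zero, Finset.mem_map]
    constructor
    · rintro rfl
      exact ⟨σ, Finset.mem_univ _, rfl⟩
    · rintro ⟨τ, -, hτ⟩
      exact (congrArg Prod.fst (Equiv.Perm.decomposeFin.symm.injective hτ)).symm
  rw [h, Finset.card_map, Finset.card_univ, Fintype.card_perm, Fintype.card_fin]

/-- Slice sums of a strongly off-diagonal hypermatrix of order `d + 1` whose value at a tuple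
enumerating the complement of `m` is `x m`. -/
lemma sum_slice_eq {d : ℕ} (hd : 0 < d) (A : (Fin d → Fin (d + 1)) → ℝ)
    (x : Fin (d + 1) → ℝ) (hA : ∀ i, ¬ Function.Injective i → A i = 0)
    (hx : ∀ (m : Fin (d + 1)) (π : Equiv.Perm (Fin d)), A (m.succAbove ∘ π) = x m)
    (k : Fin (d + 1)) :
    ∑ i ∈ Finset.univ.filter (fun i : Fin d → Fin (d + 1) => i ⟨0, hd⟩ = k), A i =
      ((d - 1).factorial : ℝ) * (∑ m, x m - x k) := by
  obtain ⟨e, rfl⟩ : ∃ e, d = e + 1 := ⟨d - 1, by omega⟩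
  have hcount : ∀ m : Fin (e + 1 + 1),
      (∑ π : Equiv.Perm (Fin (e + 1)), if m.succAbove (π 0) = k then x m else 0) =
        if m = k then 0 else (e.factorial : ℝ) * x m := by
    intro m
    split_ifs with hmk
    · subst hmk
      simp [Fin.succAbove_ne]
    · obtain ⟨j, rfl⟩ := Fin.exists_succAbove_eq (Ne.symm hmk)
      simp only [Fin.succAbove_right_inj]
      rw [← Finset.sum_filter, Finset.sum_const, card_perm_apply_zero_eq, nsmul_eq_mul]
  rw [Finset.sum_filter]
  rw [← Fintype.sum_of_injective _ (injective_succAbove_comp_perm (e + 1))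
    (fun y => if y.1.succAbove (y.2 0) = k then x y.1 else 0) _ ?_ ?_]
  · rw [Fintype.sum_prod_type]
    simp only [hcount]
    rw [Fin.sum_univ_succAbove _ k, Fin.sum_univ_succAbove x k]
    simp [Fin.succAbove_ne, Finset.mul_sum]
  · intro i hi
    have : ¬ Function.Injective i := fun h => by
      obtain ⟨m, π, rfl⟩ := exists_eq_succAbove_comp_perm h
      exact hi ⟨(m, π), rfl⟩
    simp [hA i this]
  · rintro ⟨m, π⟩
    rw [hx]
    rfl

/-- Case `n = d + 1`: if `d · r₁ ≤ ∑ᵢ rᵢ`, then `N₀(d; R)` consists of exactly one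
element `A`; for each `k`, the entry of `A` at every tuple enumerating
`{1, …, d+1} \ {k}` injectively equals `(∑ᵢ rᵢ)/d! − r_k/(d−1)!`, which is
nonnegative, and all other entries of `A` are zero. -/
theorem N0_singleton_of_succ (d : ℕ) (hd : 2 ≤ d) (R : Fin (d + 1) → ℝ)
    (hmono : ∀ i j : Fin (d + 1), i ≤ j → R j ≤ R i) (hnonneg : ∀ i, 0 ≤ R i)
    (hcond : (d : ℝ) * R ⟨0, by omega⟩ ≤ ∑ i, R i) :
    ∃ A ∈ N0 d (d + 1) (by omega : 0 < d) R,
      (∀ B ∈ N0 d (d + 1) (by omega : 0 < d) R, B = A) ∧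
      (∀ k : Fin (d + 1),
        0 ≤ (∑ i, R i) / (Nat.factorial d : ℝ) - R k / (Nat.factorial (d - 1) : ℝ) ∧
        ∀ i : Fin d → Fin (d + 1), Function.Injective i → (∀ j, i j ≠ k) →
          A i = (∑ i, R i) / (Nat.factorial d : ℝ) - R k / (Nat.factorial (d - 1) : ℝ)) ∧
      (∀ i : Fin d → Fin (d + 1),
        (¬ ∃ k : Fin (d + 1), Function.Injective i ∧ ∀ j, i j ≠ k) → A i = 0) := by
  classical
  have hd0 : 0 < d := by omega
  have hfac : (d.factorial : ℝ) = d * ((d - 1).factorial : ℝ) := by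
    exact_mod_cast (Nat.mul_factorial_pred (by omega)).symm
  have hF : (0 : ℝ) < ((d - 1).factorial : ℝ) := by positivity
  have hdR : (0 : ℝ) < d := by exact_mod_cast hd0
  set v : Fin (d + 1) → ℝ := fun k =>
    (∑ i, R i) / (d.factorial : ℝ) - R k / ((d - 1).factorial : ℝ) with hv
  have hv0 : ∀ k, 0 ≤ v k := by
    intro k
    have h1 : (d : ℝ) * R k ≤ ∑ i, R i :=
      (mul_le_mul_of_nonneg_left (hmono _ k (Fin.zero_le k)) hdR.le).trans hcond
    have h2 : v k = ((∑ i, R i) - d * R k) / (d.factorial : ℝ) := by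
      simp only [hv, hfac]
      field_simp
    rw [h2]
    exact div_nonneg (by linarith) (by positivity)
  set A : (Fin d → Fin (d + 1)) → ℝ := fun i =>
    if Function.Injective i then
      (∑ l, R l) / (d.factorial : ℝ) - (∑ l, R l - ∑ j, R (i j)) / ((d - 1).factorial : ℝ)
    else 0 with hAdef
  have hAv : ∀ (m : Fin (d + 1)) (π : Equiv.Perm (Fin d)), A (m.succAbove ∘ π) = v m := by
    intro m π
    have hinj : Function.Injective (m.succAbove ∘ π) :=
      Fin.succAbove_right_injective.comp π.injective
    have hsum : ∑ j, R ((m.succAbove ∘ π) j) = ∑ j, R (m.succAbove j) :=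
      Equiv.sum_comp π fun j => R (m.succAbove j)
    simp only [hAdef, hv, if_pos hinj, hsum]
    rw [Fin.sum_univ_succAbove R m]
    ring
  have hA0 : ∀ i, ¬ Function.Injective i → A i = 0 := fun i hi => if_neg hi
  have hsumv : ((d - 1).factorial : ℝ) * ∑ m, v m = (∑ i, R i) / d := by
    simp only [hv, Finset.sum_sub_distrib, ← Finset.sum_div, Finset.sum_const, Finset.card_univ,
      Fintype.card_fin, nsmul_eq_mul, hfac]
    push_cast
    field_simp
    ring
  refine ⟨A, ⟨?_, ?_, hA0, ?_⟩, ?_, fun k => ⟨hv0 k, ?_⟩, ?_⟩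
  · intro i
    by_cases hi : Function.Injective i
    · obtain ⟨m, π, rfl⟩ := exists_eq_succAbove_comp_perm hi
      rw [hAv]
      exact hv0 m
    · rw [hA0 i hi]
  · intro i π
    by_cases hi : Function.Injective i
    · obtain ⟨m, σ, rfl⟩ := exists_eq_succAbove_comp_perm hi
      rw [hAv, Function.comp_assoc, ← Equiv.coe_trans, hAv]
    · rw [hA0 i hi, hA0 _ (by simpa using hi)]
  · intro k
    rw [sum_slice_eq hd0 A v hA0 hAv, mul_sub, hsumv]
    simp only [hv, hfac]
    field_simp
    ring
  · rintro B ⟨-, hBsymm, hB0, hBsum⟩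
    have hBx : ∀ (m : Fin (d + 1)) (π : Equiv.Perm (Fin d)),
        B (m.succAbove ∘ π) = B m.succAbove := fun m π => hBsymm _ π
    have hslice : ∀ k, ((d - 1).factorial : ℝ) * (∑ m, B (Fin.succAbove m) - B k.succAbove)
        = R k := fun k =>
      (sum_slice_eq hd0 B (fun m => B m.succAbove) hB0 hBx k).symm.trans (hBsum k)
    have htotal : ∑ k, R k = (d.factorial : ℝ) * ∑ m, B (Fin.succAbove m) := by
      simp only [← hslice, ← Finset.mul_sum, Finset.sum_sub_distrib, Finset.sum_const,
        Finset.card_univ, Fintype.card_fin, nsmul_eq_mul, hfac]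
      push_cast
      ring
    funext i
    by_cases hi : Function.Injective i
    · obtain ⟨m, π, rfl⟩ := exists_eq_succAbove_comp_perm hi
      rw [hAv, hBx]
      simp only [hv]
      rw [htotal, ← hslice m, mul_div_cancel_left₀ _ (by positivity),
        mul_div_cancel_left₀ _ hF.ne']
      ring
    · rw [hA0 i hi, hB0 i hi]
  · intro i hi hik
    obtain ⟨m, π, rfl⟩ := exists_eq_succAbove_comp_perm hi
    have hkm : k = m := by
      by_contra hne
      obtain ⟨j, hj⟩ := Fin.exists_succAbove_eq hne
      exact hik (π.symm j) (by simp [hj])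
    rw [hAv, hkm]
  · intro i hi
    refine hA0 i fun hinj => hi ?_
    obtain ⟨m, π, rfl⟩ := exists_eq_succAbove_comp_perm hinj
    exact ⟨m, hinj, fun j => Fin.succAbove_ne m _⟩
end

section
/- Let d, n be integers with d ≥ 2 and n ≥ d, and let R = (r_1, …, r_n) with r_1 ≥ … ≥ r_n ≥ 0. Suppose N_0(d;R) is nonempty. If A is an extreme point of the convex set N_0(d;R) (viewed as a subset of the real vector space of functions {1,…,n}^d → ℝ), then the number of tuples (i_1,…,i_d) ∈ {1,…,n}^d with A(i_1,…,i_d) > 0 is at most n · d!. -/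
/-- Two injective maps with the same range differ by a permutation of the domain. -/
theorem exists_perm_comp_eq_of_range_eq {α β : Type*} {f g : α → β}
    (hf : Function.Injective f) (hg : Function.Injective g) (h : Set.range f = Set.range g) :
    ∃ π : Equiv.Perm α, g ∘ π = f := by
  refine ⟨(Equiv.ofInjective f hf).trans
    ((Equiv.setCongr h).trans (Equiv.ofInjective g hg).symm), ?_⟩
  funext x
  simp only [Function.comp_apply, Equiv.trans_apply, Equiv.apply_ofInjective_symm]
  rfl

open Classical in
/-- A finite set of injective maps has at most `d!` elements for each range occurring in it. -/
theorem card_le_factorial_mul_card_image_range {d n : ℕ} (s : Finset (Fin d → Fin n))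
    (hs : ∀ i ∈ s, Function.Injective i) :
    s.card ≤ d.factorial * (s.image fun i => Set.range i).card := by
  refine Finset.card_le_mul_card_image s _ fun a ha => ?_
  obtain ⟨j, hj, rfl⟩ := Finset.mem_image.1 ha
  calc (s.filter fun i => Set.range i = Set.range j).card
      ≤ (Finset.univ.image fun π : Equiv.Perm (Fin d) => j ∘ π).card := by
        refine Finset.card_le_card fun i hi => ?_
        obtain ⟨hi, hij⟩ := Finset.mem_filter.1 hi
        obtain ⟨π, hπ⟩ := exists_perm_comp_eq_of_range_eq (hs i hi) (hs j hj) hij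
        exact Finset.mem_image.2 ⟨π, Finset.mem_univ π, hπ⟩
    _ ≤ d.factorial := by
        refine Finset.card_image_le.trans ?_
        rw [Finset.card_univ, Fintype.card_perm, Fintype.card_fin]

/-- Rescaling the entries of a member of `N0` by factors `1 + g` that depend only on the range of
the index tuple stays in `N0`, provided that `-1 ≤ g` and the slice sums do not change. -/
theorem N0_mul_range_mem {d n : ℕ} {hd : 0 < d} {R : Fin n → ℝ} {A : (Fin d → Fin n) → ℝ}
    (hA : A ∈ N0 d n hd R) {g : Set (Fin n) → ℝ} (hg : ∀ s, -1 ≤ g s)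
    (hsum : ∀ k, ∑ i ∈ Finset.univ.filter (fun i : Fin d → Fin n => i ⟨0, hd⟩ = k),
      A i * g (Set.range i) = 0) :
    (fun i => A i * (1 + g (Set.range i))) ∈ N0 d n hd R := by
  obtain ⟨h0, hsymm, hoff, hR⟩ := hA
  refine ⟨fun i => mul_nonneg (h0 i) (by linarith [hg (Set.range i)]), fun i π => ?_,
    fun i hi => by simp [hoff i hi], fun k => ?_⟩
  · simp only [hsymm i π, EquivLike.range_comp]
  · simp only [mul_add, mul_one, Finset.sum_add_distrib, hR k, hsum k, add_zero]

/-- An extreme point of `N0` admits no nontrivial perturbation that rescales entries according to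
the range of the index tuple and preserves the slice sums. -/
theorem N0_extremePoint_mul_range_eq_zero {d n : ℕ} {hd : 0 < d} {R : Fin n → ℝ}
    {A : (Fin d → Fin n) → ℝ} (hA : A ∈ Set.extremePoints ℝ (N0 d n hd R))
    {g : Set (Fin n) → ℝ}
    (hsum : ∀ k, ∑ i ∈ Finset.univ.filter (fun i : Fin d → Fin n => i ⟨0, hd⟩ = k),
      A i * g (Set.range i) = 0) (i : Fin d → Fin n) :
    A i * g (Set.range i) = 0 := by
  obtain ⟨M, hM⟩ := (Set.finite_range fun s => |g s|).bddAbove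
  have hgM (s) : |g s| ≤ M := hM ⟨s, rfl⟩
  have hMpos : 0 < 1 + M := by linarith [hgM ∅, abs_nonneg (g ∅)]
  have hbound (s) : |(1 + M)⁻¹ * g s| ≤ 1 := by
    rw [abs_mul, abs_of_pos (inv_pos.2 hMpos), inv_mul_le_iff₀ hMpos]
    linarith [hgM s]
  have hscaled (c : ℝ) (k) :
      ∑ i ∈ Finset.univ.filter (fun i : Fin d → Fin n => i ⟨0, hd⟩ = k),
        A i * (c * g (Set.range i)) = 0 := by
    simp only [mul_left_comm _ c, ← Finset.mul_sum, hsum k, mul_zero]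
  have hplus := N0_mul_range_mem hA.1 (g := fun s => (1 + M)⁻¹ * g s)
    (fun s => (abs_le.1 (hbound s)).1) (hscaled _)
  have hminus := N0_mul_range_mem hA.1 (g := fun s => -(1 + M)⁻¹ * g s)
    (fun s => by linarith [(abs_le.1 (hbound s)).2]) (hscaled _)
  have hseg := hA.2 hplus hminus
    ⟨1 / 2, 1 / 2, by norm_num, by norm_num, by norm_num, by
      funext j
      simp only [Pi.add_apply, Pi.smul_apply, smul_eq_mul]
      ring⟩
  have hi := congrFun hseg i
  have hzero : (1 + M)⁻¹ * (A i * g (Set.range i)) = 0 := by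
    linear_combination hi
  exact (mul_eq_zero.1 hzero).resolve_left (ne_of_gt (inv_pos.2 hMpos))

/-- An extreme point of the convex set `N₀(d; R)` has at most `n · d!` positive entries. -/
theorem N0_extremePoint_support (d n : ℕ) (hd : 2 ≤ d) (hn : d ≤ n) (R : Fin n → ℝ)
    (hmono : ∀ i j : Fin n, i ≤ j → R j ≤ R i) (hnonneg : ∀ i, 0 ≤ R i)
    (hne : (N0 d n (by omega) R).Nonempty)
    (A : (Fin d → Fin n) → ℝ)
    (hA : A ∈ Set.extremePoints ℝ (N0 d n (by omega : 0 < d) R)) :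
    (Finset.univ.filter (fun i : Fin d → Fin n => 0 < A i)).card ≤ n * Nat.factorial d := by
  classical
  set S := Finset.univ.filter (fun i : Fin d → Fin n => 0 < A i)
  have hinj : ∀ i ∈ S, Function.Injective i := fun i hi => by
    by_contra h
    exact (Finset.mem_filter.1 hi).2.ne' (hA.1.2.2.1 i h)
  set T := S.image fun i => Set.range i
  suffices hcard : T.card ≤ n by
    rw [mul_comm]
    exact (card_le_factorial_mul_card_image_range S hinj).trans (Nat.mul_le_mul_left _ hcard)
  by_contra! hlt
  let L : (T → ℝ) →ₗ[ℝ] (Fin n → ℝ) :=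
    { toFun := fun g k =>
        ∑ i ∈ Finset.univ.filter (fun i : Fin d → Fin n => i ⟨0, by omega⟩ = k),
          A i * (if h : Set.range i ∈ T then g ⟨Set.range i, h⟩ else 0)
      map_add' := fun g g' => by
        funext k
        simp only [Pi.add_apply, ← Finset.sum_add_distrib]
        refine Finset.sum_congr rfl fun i _ => ?_
        split_ifs <;> ring
      map_smul' := fun c g => by
        funext k
        simp only [Pi.smul_apply, smul_eq_mul, Finset.mul_sum, RingHom.id_apply]
        refine Finset.sum_congr rfl fun i _ => ?_
        split_ifs <;> ring }
  obtain ⟨g, hgL, hg⟩ := (Submodule.ne_bot_iff _).1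
    (LinearMap.ker_ne_bot_of_finrank_lt (f := L) (by simpa using hlt))
  refine hg (funext fun s => ?_)
  obtain ⟨i, hi, his⟩ := Finset.mem_image.1 s.2
  have hmem : Set.range i ∈ T := his ▸ s.2
  have hzero := N0_extremePoint_mul_range_eq_zero hA
    (g := fun s => if h : s ∈ T then g ⟨s, h⟩ else 0) (congrFun hgL) i
  rw [dif_pos hmem] at hzero
  have hgi := (mul_eq_zero.1 hzero).resolve_left (Finset.mem_filter.1 hi).2.ne'
  have hs : s = ⟨Set.range i, hmem⟩ := Subtype.ext his.symm
  rw [hs, hgi, Pi.zero_apply]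
end

section
/- Let d, n be integers with d ≥ 2 and n ≥ d, and let D = (d_1, …, d_n) with d_1 ≥ … ≥ d_n ≥ 0. Then there exists a nonnegative weight function w on the d-element subsets of {1,…,n} such that for every vertex i ∈ {1,…,n} the weighted degree Σ_{e : i ∈ e, |e| = d} w(e) equals d_i, if and only if d·d_1 ≤ Σ_{i=1}^n d_i. -/
open Finset in
/-- In a `d`-uniform weighted hypergraph the weighted degrees sum to `d` times the total weight. -/
theorem sum_weightedDegree {ι : Type*} [Fintype ι] [DecidableEq ι] (d : ℕ)
    (w : {e : Finset ι // e.card = d} → ℝ) :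
    ∑ i, ∑ e ∈ univ.filter (fun e : {e : Finset ι // e.card = d} => i ∈ e.val), w e
      = d * ∑ e, w e := by
  simp_rw [sum_filter]
  rw [sum_comm, mul_sum]
  refine sum_congr rfl fun e _ => ?_
  rw [← sum_filter, sum_const, nsmul_eq_mul, filter_univ_mem, e.2]

open Finset in
/-- If `D` has entries in `[0, M]` and sum `d * M`, with `M > 0`, there is a `d`-set containing every
vertex where `D = M` and contained in the support of `D`. -/
theorem exists_card_eq_between_tight_and_support {ι : Type*} [Fintype ι] [DecidableEq ι]
    {d : ℕ} {M : ℝ} {D : ι → ℝ} (hM : 0 < M) (h0 : ∀ i, 0 ≤ D i) (h1 : ∀ i, D i ≤ M)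
    (hsum : ∑ i, D i = d * M) :
    ∃ e : Finset ι, e.card = d ∧ (∀ i, D i = M → i ∈ e) ∧ ∀ i ∈ e, D i ≠ 0 := by
  have tight_le : (univ.filter fun i => D i = M).card ≤ d := by
    have h : ∑ i ∈ univ.filter (fun i => D i = M), D i ≤ ∑ i, D i :=
      sum_le_sum_of_subset_of_nonneg (subset_univ _) fun i _ _ => h0 i
    rw [sum_congr rfl fun i hi => (mem_filter.1 hi).2, sum_const, nsmul_eq_mul, hsum] at h
    exact_mod_cast le_of_mul_le_mul_right h hM
  have le_support : d ≤ (univ.filter fun i => D i ≠ 0).card := by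
    have h := sum_le_card_nsmul (univ.filter fun i => D i ≠ 0) D M fun i _ => h1 i
    rw [sum_filter_ne_zero, hsum, nsmul_eq_mul] at h
    exact_mod_cast le_of_mul_le_mul_right h hM
  have tight_sub : univ.filter (fun i => D i = M) ⊆ univ.filter fun i => D i ≠ 0 := by
    intro i hi
    simp only [mem_filter, mem_univ, true_and] at hi ⊢
    exact hi ▸ hM.ne'
  obtain ⟨e, he₁, he₂, he⟩ := exists_subsuperset_card_eq tight_sub tight_le le_support
  exact ⟨e, he, fun i hi => he₁ (by simpa using hi), fun i hi => by simpa using he₂ hi⟩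

open Finset in
/-- A vector with entries in `[0, M]` and sum `d * M` is the weighted degree sequence of a
`d`-uniform weighted hypergraph. -/
theorem exists_weight_of_sum_eq {ι : Type*} [Fintype ι] [DecidableEq ι] {d : ℕ} (hd : 0 < d)
    (M : ℝ) (D : ι → ℝ) (h0 : ∀ i, 0 ≤ D i) (h1 : ∀ i, D i ≤ M) (hsum : ∑ i, D i = d * M) :
    ∃ w : {e : Finset ι // e.card = d} → ℝ, (∀ e, 0 ≤ w e) ∧
      ∀ i, ∑ e ∈ univ.filter (fun e : {e : Finset ι // e.card = d} => i ∈ e.val), w e = D i := by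
  induction hk : (univ.filter fun i => D i ≠ 0).card + (univ.filter fun i => D i ≠ M).card
    using Nat.strong_induction_on generalizing M D with
  | _ k ih =>
  have hM : 0 ≤ M := by
    have h := sum_nonneg fun i (_ : i ∈ univ) => h0 i
    rw [hsum] at h
    exact nonneg_of_mul_nonneg_right h (by exact_mod_cast hd)
  rcases hM.eq_or_lt with rfl | hM
  · exact ⟨0, fun _ => le_rfl, fun i => by simpa using le_antisymm (h0 i) (h1 i)⟩
  obtain ⟨e, he, tight_mem, ne_zero⟩ := exists_card_eq_between_tight_and_support hM h0 h1 hsum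
  have hne : Nonempty ι := (card_pos.1 (he ▸ hd)).to_type
  obtain ⟨j, hj⟩ := Finite.exists_min fun i => if i ∈ e then D i else M - D i
  set t := if j ∈ e then D j else M - D j with ht
  have ht0 : 0 ≤ t := by
    rw [ht]; split_ifs
    · exact h0 j
    · linarith [h1 j]
  have hin : ∀ i ∈ e, t ≤ D i := fun i hi => by simpa [hi] using hj i
  have hout : ∀ i ∉ e, t ≤ M - D i := fun i hi => by simpa [hi] using hj i
  set D' : ι → ℝ := fun i => D i - if i ∈ e then t else 0 with hD'
  have support_sub : (univ.filter fun i => D' i ≠ 0) ⊆ univ.filter fun i => D i ≠ 0 := by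
    intro i
    simp only [mem_filter, mem_univ, true_and, hD']
    by_cases hi : i ∈ e
    · exact fun _ => ne_zero i hi
    · simp [hi]
  have slack_sub : (univ.filter fun i => D' i ≠ M - t) ⊆ univ.filter fun i => D i ≠ M := by
    intro i
    simp only [mem_filter, mem_univ, true_and, hD']
    intro h hi
    exact h (by simp [tight_mem i hi, hi])
  have hlt : (univ.filter fun i => D' i ≠ 0).card + (univ.filter fun i => D' i ≠ M - t).card
      < k := by
    rw [← hk]
    by_cases hje : j ∈ e
    · refine add_lt_add_of_lt_of_le (card_lt_card ?_) (card_le_card slack_sub)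
      refine (ssubset_iff_of_subset support_sub).2 ⟨j, by simpa using ne_zero j hje, ?_⟩
      simp [hD', ht, hje]
    · refine add_lt_add_of_le_of_lt (card_le_card support_sub) (card_lt_card ?_)
      refine (ssubset_iff_of_subset slack_sub).2
        ⟨j, by simpa using fun h => hje (tight_mem j h), ?_⟩
      simp [hD', ht, hje]
  obtain ⟨w, hw0, hw⟩ := ih _ hlt (M - t) D'
    (fun i => by
      simp only [hD']; split_ifs with hi
      · linarith [hin i hi]
      · linarith [h0 i])
    (fun i => by
      simp only [hD']; split_ifs with hi
      · linarith [h1 i]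
      · linarith [hout i hi])
    (by simp only [hD', sum_sub_distrib, hsum, sum_ite_mem, univ_inter, sum_const, he,
          nsmul_eq_mul]; ring)
    rfl
  refine ⟨w + Pi.single ⟨e, he⟩ t, fun f => add_nonneg (hw0 f) ?_, fun i => ?_⟩
  · exact (Pi.single_nonneg.2 ht0 : (0 : {e : Finset ι // e.card = d} → ℝ) ≤ _) f
  · simp only [Pi.add_apply, sum_add_distrib, hw, sum_pi_single', hD']
    simp

/-- Existence of a `d`-uniform weighted hypergraph with weighted degree sequence
`D = (d₁ ≥ ⋯ ≥ d_n ≥ 0)`: a nonnegative weight function on the `d`-element subsets of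
`{1, …, n}` with weighted degree `dᵢ` at vertex `i` exists iff `d · d₁ ≤ ∑ᵢ dᵢ`. -/
theorem weighted_hypergraph_degree_realizable (d n : ℕ) (hd : 2 ≤ d) (hn : d ≤ n)
    (D : Fin n → ℝ)
    (hmono : ∀ i j : Fin n, i ≤ j → D j ≤ D i) (hnonneg : ∀ i, 0 ≤ D i) :
    (∃ w : {e : Finset (Fin n) // e.card = d} → ℝ,
        (∀ e, 0 ≤ w e) ∧
        ∀ i : Fin n,
          ∑ e ∈ Finset.univ.filter
              (fun e : {e : Finset (Fin n) // e.card = d} => i ∈ e.val), w e = D i) ↔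
      (d : ℝ) * D ⟨0, by omega⟩ ≤ ∑ i, D i := by
  constructor
  · rintro ⟨w, hw0, hw⟩
    rw [← Finset.sum_congr rfl fun i _ => hw i, sum_weightedDegree, ← hw]
    exact mul_le_mul_of_nonneg_left
      (Finset.sum_le_sum_of_subset_of_nonneg (Finset.subset_univ _) fun e _ _ => hw0 e)
      d.cast_nonneg
  · intro h
    have hd0 : (0 : ℝ) < d := by exact_mod_cast (by omega : 0 < d)
    refine exists_weight_of_sum_eq (by omega) ((∑ i, D i) / d) D hnonneg (fun i => ?_)
      (mul_div_cancel₀ _ hd0.ne').symm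
    rw [le_div_iff₀' hd0]
    exact (mul_le_mul_of_nonneg_left (hmono _ i (Nat.zero_le _)) hd0.le).trans h
end

section
/- Let d, n be integers with d ≥ 2 and n ≥ d, and let D = (d_1, …, d_n) with d_1 ≥ … ≥ d_n ≥ 0 and d·d_1 ≤ Σ_{i=1}^n d_i. Then there exists a nonnegative weight function w on the d-element subsets of {1,…,n} whose weighted degree at vertex i equals d_i for every i, and such that the number of d-element subsets e with w(e) > 0 is at most n. -/
/-- If the sum of numbers in `[0, M]` is an integer multiple of `M`, then it is impossible that
exactly one of them lies strictly between `0` and `M`. -/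
lemma card_filter_strictly_between_ne_one {ι : Type*} [Fintype ι]
    {d : ℕ} {M : ℝ} {D : ι → ℝ} (hM : 0 < M) (h0 : ∀ i, 0 ≤ D i) (hDM : ∀ i, D i ≤ M)
    (hsum : ∑ i, D i = d * M) :
    (Finset.univ.filter fun i => 0 < D i ∧ D i < M).card ≠ 1 := by
  classical
  intro h
  obtain ⟨a, ha⟩ := Finset.card_eq_one.mp h
  have haL : 0 < D a ∧ D a < M := by
    have : a ∈ Finset.univ.filter fun i => 0 < D i ∧ D i < M := by simp [ha]
    simpa using this
  have hrest : ∑ i ∈ Finset.univ.erase a, D i =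
      ((Finset.univ.erase a).filter fun i => D i = M).card * M := by
    rw [← nsmul_eq_mul, ← Finset.sum_const, Finset.sum_filter]
    refine Finset.sum_congr rfl fun i hi => ?_
    split_ifs with hiM
    · exact hiM
    · by_contra hne
      have : i ∈ Finset.univ.filter fun i => 0 < D i ∧ D i < M := by
        simp only [Finset.mem_filter, Finset.mem_univ, true_and]
        exact ⟨lt_of_le_of_ne (h0 i) (Ne.symm hne), lt_of_le_of_ne (hDM i) hiM⟩
      rw [ha, Finset.mem_singleton] at this
      exact (Finset.mem_erase.mp hi).1 this
  rw [← Finset.add_sum_erase _ _ (Finset.mem_univ a), hrest] at hsum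
  set k := ((Finset.univ.erase a).filter fun i => D i = M).card
  have h1 : (k : ℝ) < d := lt_of_mul_lt_mul_right (by linarith) hM.le
  have h2 : (d : ℝ) < (k + 1 : ℕ) := by
    push_cast
    exact lt_of_mul_lt_mul_right (by linarith) hM.le
  have h1' : k < d := by exact_mod_cast h1
  have h2' : d < k + 1 := by exact_mod_cast h2
  omega

/-- There is a `d`-set which contains every vertex of maximal possible degree `M` and no vertex of
degree zero. -/
lemma exists_card_eq_of_sum_eq {ι : Type*} [Fintype ι]
    {d : ℕ} {M : ℝ} {D : ι → ℝ} (hM : 0 < M) (h0 : ∀ i, 0 ≤ D i) (hDM : ∀ i, D i ≤ M)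
    (hsum : ∑ i, D i = d * M) :
    ∃ e : Finset ι, e.card = d ∧ (∀ i, D i = M → i ∈ e) ∧ ∀ i ∈ e, 0 < D i := by
  classical
  have hsub : (Finset.univ.filter fun i => D i = M) ⊆ Finset.univ.filter fun i => 0 < D i := by
    intro i
    simp only [Finset.mem_filter, Finset.mem_univ, true_and]
    intro h
    rwa [h]
  have hlow : (Finset.univ.filter fun i => D i = M).card ≤ d := by
    have h : ((Finset.univ.filter fun i => D i = M).card : ℝ) * M ≤ d * M := by
      rw [← hsum, ← nsmul_eq_mul, ← Finset.sum_const, Finset.sum_filter]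
      refine Finset.sum_le_sum fun i _ => ?_
      split_ifs with h
      · exact h.ge
      · exact h0 i
    exact_mod_cast le_of_mul_le_mul_right h hM
  have hup : d ≤ (Finset.univ.filter fun i => 0 < D i).card := by
    have h : (d : ℝ) * M ≤ (Finset.univ.filter fun i => 0 < D i).card * M := by
      rw [← hsum, ← nsmul_eq_mul, ← Finset.sum_const, Finset.sum_filter]
      refine Finset.sum_le_sum fun i _ => ?_
      split_ifs with h
      · exact hDM i
      · exact not_lt.mp h
    exact_mod_cast le_of_mul_le_mul_right h hM
  obtain ⟨e, h1, h2, h3⟩ := Finset.exists_subsuperset_card_eq hsub hlow hup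
  exact ⟨e, h3, fun i hi => h1 (by simpa using hi), fun i hi => by simpa using h2 hi⟩

/-- An edge can be given so much weight that either all of the degrees are exhausted, or fewer
of the remaining degrees lie strictly between the two bounds. -/
lemma exists_edge_weight {ι : Type*} [Fintype ι] [Nonempty ι] [DecidableEq ι]
    {d : ℕ} {M : ℝ} {D : ι → ℝ} (hM : 0 < M) (h0 : ∀ i, 0 ≤ D i) (hDM : ∀ i, D i ≤ M)
    (hsum : ∑ i, D i = d * M) :
    ∃ (e : {e : Finset ι // e.card = d}) (t : ℝ), 0 < t ∧ t ≤ M ∧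
      (∀ i, 0 ≤ D i - if i ∈ e.val then t else 0) ∧
      (∀ i, (D i - if i ∈ e.val then t else 0) ≤ M - t) ∧
      (t = M ∨
        (Finset.univ.filter fun i => 0 < (D i - if i ∈ e.val then t else 0) ∧
          (D i - if i ∈ e.val then t else 0) < M - t).card <
        (Finset.univ.filter fun i => 0 < D i ∧ D i < M).card) := by
  obtain ⟨e, hed, heM, he0⟩ := exists_card_eq_of_sum_eq hM h0 hDM hsum
  obtain ⟨a, ha⟩ := Finite.exists_min fun i => if i ∈ e then D i else M - D i
  obtain ⟨t, ht⟩ : ∃ t, t = if a ∈ e then D a else M - D a := ⟨_, rfl⟩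
  rw [← ht] at ha
  have hin : ∀ i ∈ e, t ≤ D i := fun i hi => by simpa [hi] using ha i
  have hout : ∀ i ∉ e, t ≤ M - D i := fun i hi => by simpa [hi] using ha i
  have hlt : ∀ i ∉ e, D i < M := fun i hi => lt_of_le_of_ne (hDM i) fun h => hi (heM i h)
  refine ⟨⟨e, hed⟩, t, ?_, ?_, ?_, ?_, ?_⟩
  · rw [ht]
    split_ifs with h
    · exact he0 a h
    · linarith [hlt a h]
  · rw [ht]
    split_ifs
    · exact hDM a
    · linarith [h0 a]
  · intro i
    dsimp only
    split_ifs with h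
    · linarith [hin i h]
    · linarith [h0 i]
  · intro i
    dsimp only
    split_ifs with h
    · linarith [hDM i]
    · linarith [hout i h]
  · refine or_iff_not_imp_left.mpr fun htM => Finset.card_lt_card ?_
    refine (Finset.ssubset_iff_of_subset fun i => ?_).mpr ⟨a, ?_, ?_⟩
    · simp only [Finset.mem_filter, Finset.mem_univ, true_and]
      split_ifs with h
      · exact fun hi => ⟨he0 i h, by linarith [hi.2]⟩
      · exact fun hi => ⟨by linarith [hi.1], hlt i h⟩
    · simp only [Finset.mem_filter, Finset.mem_univ, true_and]
      split_ifs at ht with h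
      · exact ⟨he0 a h, lt_of_le_of_ne (hDM a) (ht ▸ htM)⟩
      · exact ⟨lt_of_le_of_ne (h0 a) fun h' => htM (by linarith), hlt a h⟩
    · simp only [Finset.mem_filter, Finset.mem_univ, true_and]
      split_ifs at ht ⊢ with h
      · exact fun hi => by linarith [hi.1]
      · exact fun hi => by linarith [hi.2]

/-- Adding weight `t` to the edge `e` raises the degree of precisely the vertices of `e`. -/
lemma sum_filter_mem_add_single {ι : Type*} [Fintype ι] [DecidableEq ι] {d : ℕ}
    (w : {e : Finset ι // e.card = d} → ℝ) (e : {e : Finset ι // e.card = d}) (t : ℝ) (i : ι) :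
    ∑ f ∈ Finset.univ.filter (fun f : {e : Finset ι // e.card = d} => i ∈ f.val),
      (w + Pi.single e t : {e : Finset ι // e.card = d} → ℝ) f =
    ∑ f ∈ Finset.univ.filter (fun f : {e : Finset ι // e.card = d} => i ∈ f.val), w f +
      if i ∈ e.val then t else 0 := by
  simp only [Pi.add_apply, Finset.sum_add_distrib]
  rw [Finset.sum_pi_single']
  simp

/-- Nonnegative numbers that are at most `M` and sum to `d * M` are the degrees of a `d`-uniform
weighted hypergraph whose number of edges is bounded by the number of degrees strictly between
`0` and `M`, or by one if there are none. -/
lemma exists_weight_card_le {ι : Type*} [Fintype ι] [Nonempty ι] [DecidableEq ι]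
    {d : ℕ} {M : ℝ} {D : ι → ℝ} (hM : 0 < M) (h0 : ∀ i, 0 ≤ D i) (hDM : ∀ i, D i ≤ M)
    (hsum : ∑ i, D i = d * M) :
    ∃ w : {e : Finset ι // e.card = d} → ℝ,
      (∀ e, 0 ≤ w e) ∧
      (∀ i, ∑ e ∈ Finset.univ.filter
        (fun e : {e : Finset ι // e.card = d} => i ∈ e.val), w e = D i) ∧
      (Finset.univ.filter fun e => 0 < w e).card ≤
        max (Finset.univ.filter fun i => 0 < D i ∧ D i < M).card 1 := by
  induction hL : (Finset.univ.filter fun i => 0 < D i ∧ D i < M).card using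
    Nat.strong_induction_on generalizing M D with
  | _ L ih =>
  obtain ⟨e, t, ht0, htM, hD0, hDt, hcase⟩ := exists_edge_weight hM h0 hDM hsum
  have hone := card_filter_strictly_between_ne_one hM h0 hDM hsum
  obtain ⟨w, hw0, hwD, hwc⟩ : ∃ w : {e : Finset ι // e.card = d} → ℝ,
      (∀ e, 0 ≤ w e) ∧
      (∀ i, ∑ e ∈ Finset.univ.filter
        (fun e : {e : Finset ι // e.card = d} => i ∈ e.val), w e =
          D i - if i ∈ e.val then t else 0) ∧
      (Finset.univ.filter fun e => 0 < w e).card + 1 ≤ max L 1 := by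
    rcases htM.eq_or_lt with rfl | hlt
    · refine ⟨0, fun _ => le_rfl, fun i => ?_, by simp⟩
      have h1 := hD0 i
      have h2 := hDt i
      simp only [Pi.zero_apply, Finset.sum_const_zero]
      linarith
    · have hcard := hcase.resolve_left hlt.ne
      have hsum' : ∑ i, (D i - if i ∈ e.val then t else 0) = d * (M - t) := by
        rw [Finset.sum_sub_distrib, hsum, Finset.sum_ite_mem, Finset.univ_inter,
          Finset.sum_const, e.property, nsmul_eq_mul]
        ring
      obtain ⟨w, hw0, hwD, hwc⟩ := ih _ (hL ▸ hcard) (sub_pos.mpr hlt) hD0 hDt hsum' rfl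
      exact ⟨w, hw0, hwD, by omega⟩
  refine ⟨w + Pi.single e t, fun f => ?_, fun i => ?_, ?_⟩
  · have hsingle : (0 : {e : Finset ι // e.card = d} → ℝ) ≤ Pi.single e t :=
      Pi.single_nonneg.mpr ht0.le
    exact add_nonneg (hw0 f) (hsingle f)
  · rw [sum_filter_mem_add_single, hwD]
    ring
  · refine le_trans (le_trans (Finset.card_le_card fun f => ?_)
      (Finset.card_insert_le e (Finset.univ.filter fun e => 0 < w e))) hwc
    rcases eq_or_ne f e with rfl | hf
    · simp
    · simp [hf]

/-- If `d · d₁ ≤ ∑ᵢ dᵢ`, then there is a `d`-uniform weighted hypergraph with weighted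
degree sequence `D` having at most `n` edges of positive weight. -/
theorem weighted_hypergraph_sparse (d n : ℕ) (hd : 2 ≤ d) (hn : d ≤ n)
    (D : Fin n → ℝ)
    (hmono : ∀ i j : Fin n, i ≤ j → D j ≤ D i) (hnonneg : ∀ i, 0 ≤ D i)
    (hcond : (d : ℝ) * D ⟨0, by omega⟩ ≤ ∑ i, D i) :
    ∃ w : {e : Finset (Fin n) // e.card = d} → ℝ,
      (∀ e, 0 ≤ w e) ∧
      (∀ i : Fin n,
        ∑ e ∈ Finset.univ.filter
            (fun e : {e : Finset (Fin n) // e.card = d} => i ∈ e.val), w e = D i) ∧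
      (Finset.univ.filter
          (fun e : {e : Finset (Fin n) // e.card = d} => 0 < w e)).card ≤ n := by
  have : Nonempty (Fin n) := ⟨⟨0, by omega⟩⟩
  have hd0 : (0 : ℝ) < d := by
    have : 0 < d := by omega
    exact_mod_cast this
  have hDM : ∀ i, D i ≤ (∑ j, D j) / d := fun i => by
    rw [le_div_iff₀ hd0, mul_comm]
    exact (mul_le_mul_of_nonneg_left (hmono ⟨0, by omega⟩ i (Nat.zero_le _)) hd0.le).trans hcond
  rcases (Finset.sum_nonneg fun i _ => hnonneg i : 0 ≤ ∑ j, D j).eq_or_lt with hz | hpos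
  · refine ⟨0, fun _ => le_rfl, fun i => ?_, by simp⟩
    have h := hDM i
    rw [← hz, zero_div] at h
    simpa using (hnonneg i).antisymm h
  · obtain ⟨w, hw0, hwD, hwc⟩ := exists_weight_card_le (d := d) (div_pos hpos hd0) hnonneg hDM
      (by field_simp)
    refine ⟨w, hw0, hwD, hwc.trans (max_le ?_ (by omega))⟩
    exact (Finset.card_le_univ _).trans_eq (Fintype.card_fin n)
end

section
/- Let d ≥ 2 and n = d or n = d + 1, and let D = (d_1, …, d_n) with d_1 ≥ … ≥ d_n ≥ 0 satisfying d·d_1 ≤ Σ_{i=1}^n d_i. Then there exists exactly one nonnegative weight function w on the d-element subsets of {1,…,n} whose weighted degree at vertex i equals d_i for every i ∈ {1,…,n}. -/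
/-- The `d`-element subsets of a `(d + 1)`-element type are the complements of singletons. -/
noncomputable def complSingletonEquiv (d : ℕ) :
    Fin (d + 1) ≃ {e : Finset (Fin (d + 1)) // e.card = d} :=
  Equiv.ofBijective (fun j => ⟨{j}ᶜ, by simp [Finset.card_compl]⟩) <| by
    refine ⟨fun i j h => by simpa using h, fun ⟨e, he⟩ => ?_⟩
    obtain ⟨j, hj⟩ : ∃ j, eᶜ = {j} := by
      rw [← Finset.card_eq_one, Finset.card_compl, he, Fintype.card_fin]
      omega
    exact ⟨j, Subtype.ext (by simp [← hj])⟩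

theorem mem_complSingletonEquiv {d : ℕ} (i j : Fin (d + 1)) :
    i ∈ (complSingletonEquiv d j).val ↔ i ≠ j := by
  change i ∈ ({j}ᶜ : Finset (Fin (d + 1))) ↔ i ≠ j
  simp

theorem sum_filter_mem_eq_sum_sub {d : ℕ}
    (w : {e : Finset (Fin (d + 1)) // e.card = d} → ℝ) (i : Fin (d + 1)) :
    ∑ e ∈ Finset.univ.filter
        (fun e : {e : Finset (Fin (d + 1)) // e.card = d} => i ∈ e.val), w e =
      ∑ j, w (complSingletonEquiv d j) - w (complSingletonEquiv d i) := by
  rw [Finset.sum_filter, ← (complSingletonEquiv d).sum_comp,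
    ← Finset.sum_erase_eq_sub (Finset.mem_univ i), ← Finset.filter_ne, Finset.sum_filter]
  simp only [mem_complSingletonEquiv]

theorem forall_sum_sub_eq_iff {d : ℕ} (hd : d ≠ 0) (v D : Fin (d + 1) → ℝ) :
    (∀ i, ∑ j, v j - v i = D i) ↔ ∀ i, v i = (∑ j, D j) / d - D i := by
  have hd' : (d : ℝ) ≠ 0 := Nat.cast_ne_zero.mpr hd
  constructor
  · intro h i
    have hsum : ∑ j, D j = d * ∑ j, v j := by
      simp_rw [← h, Finset.sum_sub_distrib]
      simp
      ring
    rw [hsum, mul_div_cancel_left₀ _ hd', ← h i]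
    ring
  · intro h i
    simp_rw [h, Finset.sum_sub_distrib]
    simp
    field_simp
    ring


/-- For `n = d` or `n = d + 1`, if `d · d₁ ≤ ∑ᵢ dᵢ`, then there is a *unique*
nonnegative weight function on the `d`-element subsets of `{1, …, n}` with weighted
degree `dᵢ` at vertex `i` for every `i`. -/
theorem weighted_hypergraph_unique (d n : ℕ) (hd : 2 ≤ d) (hn : n = d ∨ n = d + 1)
    (D : Fin n → ℝ)
    (hmono : ∀ i j : Fin n, i ≤ j → D j ≤ D i) (hnonneg : ∀ i, 0 ≤ D i)
    (hcond : (d : ℝ) * D ⟨0, by omega⟩ ≤ ∑ i, D i) :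
    ∃! w : {e : Finset (Fin n) // e.card = d} → ℝ,
      (∀ e, 0 ≤ w e) ∧
      ∀ i : Fin n,
        ∑ e ∈ Finset.univ.filter
            (fun e : {e : Finset (Fin n) // e.card = d} => i ∈ e.val), w e = D i := by
  rcases hn with rfl | rfl
  · have hn : 0 < n := by omega
    have hle : ∀ i, D i ≤ D ⟨0, hn⟩ := fun i => hmono _ _ (Nat.zero_le _)
    have hD : ∀ i, D i = D ⟨0, hn⟩ := by
      have hsum : ∑ i, D i = ∑ _i : Fin n, D ⟨0, hn⟩ :=
        le_antisymm (Finset.sum_le_sum fun i _ => hle i) (by simpa using hcond)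
      simpa using (Finset.sum_eq_sum_iff_of_le fun i _ => hle i).mp hsum
    have huniv : ∀ e : {e : Finset (Fin n) // e.card = n}, e.val = Finset.univ := fun e =>
      (Finset.card_eq_iff_eq_univ _).mp (by simpa using e.property)
    have hdeg : ∀ (w : {e : Finset (Fin n) // e.card = n} → ℝ) (i : Fin n) e,
        ∑ e ∈ Finset.univ.filter
          (fun e : {e : Finset (Fin n) // e.card = n} => i ∈ e.val), w e = w e := by
      intro w i e
      have : Subsingleton {e : Finset (Fin n) // e.card = n} :=
        ⟨fun a b => Subtype.ext ((huniv a).trans (huniv b).symm)⟩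
      rw [Finset.filter_true_of_mem fun a _ => by simp [huniv a], Fintype.sum_subsingleton _ e]
    refine ⟨fun _ => D ⟨0, hn⟩, ⟨fun _ => hnonneg _, fun i => ?_⟩, fun w hw => funext fun e => ?_⟩
    · rw [hdeg _ i ⟨Finset.univ, by simp⟩, hD i]
    · rw [← hdeg w ⟨0, hn⟩ e, hw.2]
  · have hd0 : d ≠ 0 := by omega
    have hchar (w : {e : Finset (Fin (d + 1)) // e.card = d} → ℝ) :=
      forall_sum_sub_eq_iff hd0 (fun j => w (complSingletonEquiv d j)) D
    simp only [sum_filter_mem_eq_sum_sub, hchar]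
    refine ⟨fun e => (∑ j, D j) / d - D ((complSingletonEquiv d).symm e), ⟨fun e => ?_, ?_⟩, ?_⟩
    · rw [sub_nonneg, le_div_iff₀ (by positivity), mul_comm]
      exact (mul_le_mul_of_nonneg_left (hmono _ _ (Nat.zero_le _)) (by positivity)).trans hcond
    · simp
    · rintro w ⟨-, hw⟩
      funext e
      simpa using hw ((complSingletonEquiv d).symm e)
end
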